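/- For the step potential setup (g_L = -d²/dx² + v₀L²𝟙_{[-b/L,b/L]}, Dirichlet on (-1/2,1/2)), with X₀ := (ω₀/M₀)(tanh(M₀ l₂))^{-1} and X₁ := (ω₁/M₁)tanh(M₁ l₂), the difference of frequencies satisfies ω₁ − ω₀ = l₁^{-1} ∫_{X₁}^{X₀} dt/(1+t²), and hence l₁^{-1}(X₀ − X₁)/(1 + X₀²) ≤ ω₁ − ω₀ ≤ l₁^{-1}(X₀ − X₁)/(1 + X₁²). Since M_j l₂ → √(v₀) b·(something of order 1) as L → ∞, this yields c₁/L ≤ ω₁ − ω₀ ≤ c₂/L for constants c₁, c₂ > 0 and L large. -/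

import Mathlib

open MeasureTheory Filter Real Set

/-- Rayleigh quotient of the Schrödinger form `∫ (f')² + v f²` over `∫ f²` on `(a,b)`. -/
noncomputable def rayleighQuotient (v : ℝ → ℝ) (a b : ℝ) (f : ℝ → ℝ) : ℝ :=
  (∫ x in a..b, ((deriv f x) ^ 2 + v x * (f x) ^ 2)) / (∫ x in a..b, (f x) ^ 2)

/-- Smooth test functions compactly supported in the open interval `(a,b)`
(a form core for the Dirichlet realization). -/
def IsTestFun (a b : ℝ) (f : ℝ → ℝ) : Prop :=
  ContDiff ℝ (⊤ : ℕ∞) f ∧ tsupport f ⊆ Set.Ioo a b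

/-- `n`-th Dirichlet eigenvalue (counted from `n = 0`, with multiplicity) of
`-d²/dx² + v` on `(a,b)`, via the Courant–Fischer min-max principle. -/
noncomputable def dirichletEV (v : ℝ → ℝ) (a b : ℝ) (n : ℕ) : ℝ :=
  ⨅ W : {W : Submodule ℝ (ℝ → ℝ) //
      Module.finrank ℝ (↥W) = n + 1 ∧ ∀ f ∈ W, IsTestFun a b f},
    ⨆ f : {f : ℝ → ℝ // f ∈ W.1 ∧ f ≠ 0}, rayleighQuotient v a b f.1

/-- Spectral gap `Γ_v(L) = ε₁(L) - ε₀(L)` of `-d²/dx² + v` on `(-L/2, L/2)`. -/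
noncomputable def spectralGap (v : ℝ → ℝ) (L : ℝ) : ℝ :=
  dirichletEV v (-(L/2)) (L/2) 1 - dirichletEV v (-(L/2)) (L/2) 0

/-- Rescaled step potential `w_L = v₀ L² 𝟙_{[-b/L, b/L]}` on `(-1/2,1/2)`. -/
noncomputable def stepW (v₀ b L : ℝ) : ℝ → ℝ := fun x => if |x| ≤ b / L then v₀ * L ^ 2 else 0


/-- Data of a positive Dirichlet eigenfunction on `(a,b)`. -/
structure PosEig (v φ dφ d2 : ℝ → ℝ) (lam a b c : ℝ) : Prop where
  hab : a < b
  der : ∀ x, HasDerivAt φ (dφ x) x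
  cont : Continuous dφ
  rder : ∀ x, HasDerivWithinAt dφ (d2 x) (Ioi x) x
  le : ∀ x ∈ Ioo a b, d2 x ≤ (v x - lam) * φ x
  eq : ∀ x ∈ Ioo a b, x ≠ c → d2 x = (v x - lam) * φ x
  pos : ∀ x ∈ Ioo a b, 0 < φ x
  za : φ a = 0
  zb : φ b = 0
  da : dφ a ≠ 0
  db : dφ b ≠ 0

theorem glue_hasDerivAt {f g f' g' : ℝ → ℝ} {c : ℝ} (hf : ∀ x, HasDerivAt f (f' x) x)
    (hg : ∀ x, HasDerivAt g (g' x) x) (h0 : f c = g c) (h1 : f' c = g' c) (x : ℝ) :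
    HasDerivAt (fun x => if x < c then f x else g x) (if x < c then f' x else g' x) x := by
  rcases lt_trichotomy x c with h | h | h
  · rw [if_pos h]
    refine (hf x).congr_of_eventuallyEq ?_
    filter_upwards [Iio_mem_nhds h] with y hy
    exact if_pos hy
  · subst h
    rw [if_neg (lt_irrefl x)]
    have hL : HasDerivWithinAt (fun y => if y < x then f y else g y) (g' x) (Iic x) x := by
      rw [← h1]
      refine (hf x).hasDerivWithinAt.congr ?_ ?_
      · intro y hy
        rcases lt_or_eq_of_le (show y ≤ x from hy) with h | h
        · simp [h]
        · subst h; simp [h0]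
      · simp [h0]
    have hR : HasDerivWithinAt (fun y => if y < x then f y else g y) (g' x) (Ici x) x := by
      refine (hg x).hasDerivWithinAt.congr ?_ ?_
      · intro y hy
        simp [not_lt.mpr (show x ≤ y from hy)]
      · simp
    have := hL.union hR
    rwa [Iic_union_Ici, hasDerivWithinAt_univ] at this
  · rw [if_neg (not_lt.mpr h.le)]
    refine (hg x).congr_of_eventuallyEq ?_
    filter_upwards [Ioi_mem_nhds h] with y hy
    exact if_neg (not_lt.mpr (le_of_lt hy))

theorem glue_rder {f g f' g' : ℝ → ℝ} {c : ℝ} (hf : ∀ x, HasDerivWithinAt f (f' x) (Ioi x) x)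
    (hg : ∀ x, HasDerivWithinAt g (g' x) (Ioi x) x) (x : ℝ) :
    HasDerivWithinAt (fun x => if x < c then f x else g x) (if x < c then f' x else g' x)
      (Ioi x) x := by
  by_cases h : x < c
  · rw [if_pos h]
    refine (hf x).congr_of_eventuallyEq ?_ (if_pos h)
    filter_upwards [mem_nhdsWithin_of_mem_nhds (Iio_mem_nhds h)] with y hy
    exact if_pos hy
  · rw [if_neg h]
    refine (hg x).congr_of_eventuallyEq ?_ (if_neg h)
    filter_upwards [self_mem_nhdsWithin] with y hy
    exact if_neg (not_lt.mpr ((not_lt.mp h).trans (le_of_lt hy)))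

theorem glue_cont {f g : ℝ → ℝ} {c : ℝ} (hf : Continuous f) (hg : Continuous g) (h : f c = g c) :
    Continuous (fun x => if x < c then f x else g x) := by
  have h2 : (fun x => if x < c then f x else g x) = (fun x => if x ≤ c then f x else g x) := by
    funext x
    rcases lt_trichotomy x c with h' | h' | h'
    · simp [h', h'.le]
    · subst h'; simp [h]
    · simp [not_lt.mpr h'.le, not_le.mpr h']
  rw [h2]
  refine Continuous.if_le hf hg continuous_id continuous_const ?_
  intro x hx
  have : x = c := hx
  rw [this, h]

theorem quot_tendsto {φ dφ f df : ℝ → ℝ} {a : ℝ}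
    (hφ : HasDerivAt φ (dφ a) a) (hf : HasDerivAt f (df a) a) (cφ : ContinuousAt dφ a)
    (za : φ a = 0) (da : dφ a ≠ 0) (fa : f a = 0) :
    ContinuousAt (fun x => dφ x * ((f x) ^ 2 / φ x)) a := by
  rw [continuousAt_iff_punctured_nhds]
  have h1 := hasDerivAt_iff_tendsto_slope.mp hφ
  have h2 := hasDerivAt_iff_tendsto_slope.mp hf
  have h3 : Tendsto f (nhdsWithin a {a}ᶜ) (nhds 0) := by
    have := hf.continuousAt.tendsto.mono_left (nhdsWithin_le_nhds (s := {a}ᶜ))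
    rwa [fa] at this
  have h4 := cφ.tendsto.mono_left (nhdsWithin_le_nhds (s := {a}ᶜ))
  have h5 := h4.mul ((h3.mul h2).div h1 da)
  simp only [za, fa]
  have e : dφ a * (0 ^ 2 / 0) = dφ a * (0 * df a / dφ a) := by simp
  rw [e]
  refine h5.congr' ?_
  filter_upwards [self_mem_nhdsWithin] with x hx
  have hx : x - a ≠ 0 := sub_ne_zero.mpr hx
  simp only [slope_def_field, Pi.div_apply, za, fa, sub_zero]
  field_simp

theorem PosEig.lower {v φ dφ d2 : ℝ → ℝ} {lam a b c : ℝ} (H : PosEig v φ dφ d2 lam a b c)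
    (hv : ∀ a b, IntervalIntegrable v volume a b) {f : ℝ → ℝ} (hf : Differentiable ℝ f)
    (hdf : Continuous (deriv f)) (fa : f a = 0) (fb : f b = 0) :
    lam * (∫ x in a..b, (f x) ^ 2) ≤ ∫ x in a..b, ((deriv f x) ^ 2 + v x * (f x) ^ 2) := by
  have cf := hf.continuous
  have i1 : IntervalIntegrable (fun x => (deriv f x) ^ 2 + v x * (f x) ^ 2) volume a b :=
    ((hdf.pow 2).intervalIntegrable _ _).add ((hv a b).mul_continuousOn (cf.pow 2).continuousOn)
  have i2 : IntervalIntegrable (fun x => lam * (f x) ^ 2) volume a b :=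
    (continuous_const.mul (cf.pow 2)).intervalIntegrable _ _
  have key := intervalIntegral.sub_le_integral_of_hasDeriv_right_of_le
    (g := fun x => dφ x * ((f x) ^ 2 / φ x))
    (g' := fun x => d2 x * ((f x) ^ 2 / φ x) + dφ x *
      (((2 * f x * deriv f x) * φ x - (f x) ^ 2 * dφ x) / (φ x) ^ 2))
    (φ := fun x => ((deriv f x) ^ 2 + v x * (f x) ^ 2) - lam * (f x) ^ 2) H.hab.le ?_ ?_ ?_ ?_
  · simp only [fa, fb] at key
    rw [intervalIntegral.integral_sub i1 i2, intervalIntegral.integral_const_mul] at key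
    simp at key
    linarith
  · intro x hx
    apply ContinuousAt.continuousWithinAt
    rcases eq_or_lt_of_le hx.1 with h | h
    · subst h
      exact quot_tendsto (H.der _) (hf _).hasDerivAt H.cont.continuousAt H.za H.da fa
    rcases eq_or_lt_of_le hx.2 with h' | h'
    · subst h'
      exact quot_tendsto (H.der _) (hf _).hasDerivAt H.cont.continuousAt H.zb H.db fb
    have := (H.pos x ⟨h, h'⟩).ne'
    exact H.cont.continuousAt.mul ((cf.continuousAt.pow 2).div (H.der x).continuousAt this)
  · intro x hx
    have hp := (H.pos x hx).ne'
    have h1 : HasDerivAt (fun x => (f x) ^ 2) (2 * f x * deriv f x) x := by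
      have := (hf x).hasDerivAt.fun_pow 2
      simpa using this
    exact (H.rder x).mul ((h1.div (H.der x) hp).hasDerivWithinAt)
  · have := i1.sub i2
    rwa [intervalIntegrable_iff_integrableOn_Icc_of_le H.hab.le] at this
  · intro x hx
    have hp := (H.pos x hx)
    have h1 := H.le x hx
    have h2 : d2 x * ((f x) ^ 2 / φ x) ≤ (v x - lam) * φ x * ((f x) ^ 2 / φ x) :=
      mul_le_mul_of_nonneg_right h1 (by positivity)
    have h3 : (v x - lam) * φ x * ((f x) ^ 2 / φ x) = (v x - lam) * (f x) ^ 2 := by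
      field_simp
    have h4 : dφ x * (((2 * f x * deriv f x) * φ x - (f x) ^ 2 * dφ x) / (φ x) ^ 2)
      = (deriv f x) ^ 2 - (deriv f x - dφ x / φ x * f x) ^ 2 := by
      field_simp; ring
    rw [h4]
    nlinarith [sq_nonneg (deriv f x - dφ x / φ x * f x)]

theorem PosEig.energy {v φ dφ d2 : ℝ → ℝ} {lam a b c : ℝ} (H : PosEig v φ dφ d2 lam a b c)
    (hv : ∀ a b, IntervalIntegrable v volume a b) :
    ∫ x in a..b, ((dφ x) ^ 2 + v x * (φ x) ^ 2) = lam * ∫ x in a..b, (φ x) ^ 2 := by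
  have cf : Continuous φ := continuous_iff_continuousAt.mpr fun x => (H.der x).continuousAt
  have i1 : IntervalIntegrable (fun x => (dφ x) ^ 2 + v x * (φ x) ^ 2) volume a b :=
    ((H.cont.pow 2).intervalIntegrable _ _).add ((hv a b).mul_continuousOn (cf.pow 2).continuousOn)
  have i2 : IntervalIntegrable (fun x => lam * (φ x) ^ 2) volume a b :=
    (continuous_const.mul (cf.pow 2)).intervalIntegrable _ _
  have hae : ∀ᵐ x : ℝ, x ∈ uIoc a b → ((dφ x) ^ 2 + v x * (φ x) ^ 2) - lam * (φ x) ^ 2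
      = d2 x * φ x + dφ x * dφ x := by
    have n1 : ∀ᵐ x : ℝ, x ≠ c := by simp [ae_iff]
    have n2 : ∀ᵐ x : ℝ, x ≠ b := by simp [ae_iff]
    filter_upwards [n1, n2] with x h1 h2 hx
    rw [uIoc_of_le H.hab.le] at hx
    rw [H.eq x ⟨hx.1, lt_of_le_of_ne hx.2 h2⟩ h1]
    ring
  have key := intervalIntegral.integral_eq_sub_of_hasDeriv_right_of_le
    (f := fun x => dφ x * φ x) (f' := fun x => d2 x * φ x + dφ x * dφ x) H.hab.le
    (H.cont.mul cf).continuousOn (fun x _ => (H.rder x).mul (H.der x).hasDerivWithinAt)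
    ((i1.sub i2).congr_ae ((ae_restrict_iff' measurableSet_uIoc).mpr hae))
  rw [← intervalIntegral.integral_congr_ae hae, intervalIntegral.integral_sub i1 i2,
    intervalIntegral.integral_const_mul, H.za, H.zb] at key
  simp at key
  linarith

theorem approx_test {φ dφ : ℝ → ℝ} {a b : ℝ} (hab : a < b)
    (der : ∀ x, HasDerivAt φ (dφ x) x) (cont : Continuous dφ) (za : φ a = 0) (zb : φ b = 0) :
    ∃ F : ℕ → ℝ → ℝ, (∀ n, IsTestFun a b (F n)) ∧ ∃ K : ℝ, 0 ≤ K ∧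
      (∀ n, ∀ x ∈ Icc a b, |F n x| ≤ K ∧ |deriv (F n) x| ≤ K) ∧
      ∀ x ∈ Ioo a b, Tendsto (fun n => F n x) atTop (nhds (φ x)) ∧
        Tendsto (fun n => deriv (F n) x) atTop (nhds (dφ x)) := by
  set r := (b - a) / 2 with hr
  set m := (a + b) / 2 with hm
  have r0 : 0 < r := by rw [hr]; linarith
  have hq : ∀ n : ℕ, (1:ℝ) / (n + 2) ≤ 1 / 2 ∧ (1:ℝ) / (n + 3) < 1 / (n + 2) ∧
      (0:ℝ) < 1 / (n + 3) := by
    intro n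
    have : (0:ℝ) ≤ n := Nat.cast_nonneg n
    refine ⟨?_, ?_, by positivity⟩
    · exact one_div_le_one_div_of_le (by norm_num) (by linarith)
    · exact one_div_lt_one_div_of_lt (by linarith) (by linarith)
  let χ : ℕ → ContDiffBump m := fun n =>
    { rIn := r * (1 - 1 / (n + 2))
      rOut := r * (1 - 1 / (n + 3))
      rIn_pos := mul_pos r0 (by linarith [(hq n).1])
      rIn_lt_rOut := mul_lt_mul_of_pos_left (by linarith [(hq n).2.1]) r0 }
  have hout : ∀ n, (χ n).rOut < r := by
    intro n
    change r * (1 - 1 / ((n:ℝ) + 3)) < r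
    nlinarith [(hq n).2.2]
  have hχ1 : ∀ x ∈ Ioo a b, ∀ᶠ n in atTop, χ n x = 1 := by
    intro x hx
    have t : Tendsto (fun n : ℕ => r * (1 - 1 / ((n:ℝ) + 2))) atTop (nhds (r * (1 - 0))) := by
      refine Tendsto.const_mul _ (Tendsto.const_sub _ ?_)
      refine Tendsto.div_atTop tendsto_const_nhds ?_
      exact tendsto_atTop_add_const_right _ _ tendsto_natCast_atTop_atTop
    have hx' : |x - m| < r * (1 - 0) := by
      rw [abs_lt]; constructor <;> linarith [hx.1, hx.2]
    filter_upwards [t.eventually (lt_mem_nhds hx')] with n hn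
    apply (χ n).one_of_mem_closedBall
    rw [Metric.mem_closedBall, Real.dist_eq]
    exact hn.le
  have hχb : ∀ n x, |χ n x| ≤ 1 := fun n x => by
    rw [abs_of_nonneg (χ n).nonneg]; exact (χ n).le_one
  have hχ0 : ∀ n x, (χ n).rOut < |x - m| → χ n x = 0 := by
    intro n x hx
    apply (χ n).zero_of_le_dist
    rw [Real.dist_eq]; exact hx.le
  have hχc : ∀ n, ContDiff ℝ (⊤ : ℕ∞) (χ n) := fun n => (χ n).contDiff
  choose p hp using fun n : ℕ => exists_polynomial_near_of_continuousOn a b dφ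
    cont.continuousOn (1 / ((n:ℝ) + 1)) (by positivity)
  have hpt : ∀ x ∈ Icc a b, Tendsto (fun n => (p n).eval x) atTop (nhds (dφ x)) := by
    intro x hx
    rw [tendsto_iff_dist_tendsto_zero]
    refine squeeze_zero (fun _ => dist_nonneg) (fun n => (hp n x hx).le)
      tendsto_one_div_add_atTop_nhds_zero_nat
  obtain ⟨C, hC⟩ := isCompact_Icc.exists_bound_of_continuousOn (s := Icc a b) cont.continuousOn
  have hpb : ∀ n, ∀ x ∈ Icc a b, |(p n).eval x| ≤ C + 1 := by
    intro n x hx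
    have h1 := hp n x hx
    have h2 := hC x hx
    rw [Real.norm_eq_abs] at h2
    have h3 : (1:ℝ) / ((n:ℝ) + 1) ≤ 1 := by
      rw [div_le_one (by positivity)]; linarith [(Nat.cast_nonneg n : (0:ℝ) ≤ n)]
    calc |(p n).eval x| = |((p n).eval x - dφ x) + dφ x| := by ring_nf
      _ ≤ _ := abs_add_le _ _
      _ ≤ _ := by linarith
  have n2 : ∀ᵐ x : ℝ, x ≠ b := by simp [ae_iff]
  have sub : uIoc a b ⊆ Icc a b := by rw [uIoc_of_le hab.le]; exact Ioc_subset_Icc_self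
  have I1 : Tendsto (fun n => ∫ x in a..b, χ n x * (p n).eval x) atTop
      (nhds (∫ x in a..b, dφ x)) := by
    refine intervalIntegral.tendsto_integral_filter_of_dominated_convergence (fun _ => C + 1)
      (Eventually.of_forall fun n =>
        ((hχc n).continuous.mul (p n).continuous).aestronglyMeasurable) ?_
      intervalIntegrable_const ?_
    · refine Eventually.of_forall fun n => Eventually.of_forall fun x hx => ?_
      rw [norm_mul, Real.norm_eq_abs, Real.norm_eq_abs]
      have := hpb n x (sub hx)
      nlinarith [hχb n x, abs_nonneg (χ n x), abs_nonneg ((p n).eval x)]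
    · filter_upwards [n2] with x hxb hx
      have hx' := hx
      rw [uIoc_of_le hab.le] at hx
      refine (hpt x (sub hx')).congr' ?_
      filter_upwards [hχ1 x ⟨hx.1, lt_of_le_of_ne hx.2 hxb⟩] with n hn
      rw [hn, one_mul]
  have I2 : Tendsto (fun n => ∫ x in a..b, χ n x) atTop (nhds (∫ x in a..b, (1:ℝ))) := by
    refine intervalIntegral.tendsto_integral_filter_of_dominated_convergence (fun _ => 1)
      (Eventually.of_forall fun n => (hχc n).continuous.aestronglyMeasurable) ?_
      intervalIntegrable_const ?_
    · exact Eventually.of_forall fun n => Eventually.of_forall fun x hx => hχb n x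
    · filter_upwards [n2] with x hxb hx
      rw [uIoc_of_le hab.le] at hx
      refine tendsto_const_nhds.congr' ?_
      filter_upwards [hχ1 x ⟨hx.1, lt_of_le_of_ne hx.2 hxb⟩] with n hn
      rw [hn]
  have e1 : ∫ x in a..b, dφ x = 0 := by
    rw [intervalIntegral.integral_eq_sub_of_hasDerivAt (fun x _ => der x)
      (cont.intervalIntegrable _ _), za, zb, sub_zero]
  have hχpos : ∀ n, 0 < ∫ x in a..b, χ n x := by
    intro n
    refine intervalIntegral.integral_pos hab (hχc n).continuous.continuousOn
      (fun x _ => (χ n).nonneg) ⟨m, ⟨by linarith, by linarith⟩, ?_⟩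
    rw [(χ n).one_of_mem_closedBall (Metric.mem_closedBall_self (χ n).rIn_pos.le)]
    exact one_pos
  let c : ℕ → ℝ := fun n => (∫ x in a..b, χ n x * (p n).eval x) / (∫ x in a..b, χ n x)
  have hc : Tendsto c atTop (nhds 0) := by
    have := I1.div I2 (by simp; linarith)
    rw [e1, zero_div] at this
    exact this
  obtain ⟨C', hC'⟩ := (Metric.isBounded_range_of_tendsto c hc).exists_norm_le
  have hC' : ∀ n, |c n| ≤ C' := fun n => hC' _ ⟨n, rfl⟩
  let g : ℕ → ℝ → ℝ := fun n x => χ n x * ((p n).eval x - c n)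
  have hgs : ∀ n, ContDiff ℝ (⊤ : ℕ∞) (g n) := fun n =>
    (hχc n).mul (((p n).contDiff_aeval _).sub contDiff_const)
  have hg0 : ∀ n, ∫ x in a..b, g n x = 0 := by
    intro n
    have : ∀ x, g n x = χ n x * (p n).eval x - c n * χ n x := fun x => by simp only [g]; ring
    simp_rw [this]
    have j1 : IntervalIntegrable (fun x => χ n x * (p n).eval x) volume a b :=
      ((hχc n).continuous.mul (p n).continuous).intervalIntegrable _ _
    have j2 : IntervalIntegrable (fun x => c n * χ n x) volume a b :=
      (continuous_const.mul (hχc n).continuous).intervalIntegrable _ _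
    rw [intervalIntegral.integral_sub j1 j2,
      intervalIntegral.integral_const_mul]
    simp only [c]
    rw [div_mul_cancel₀ _ (hχpos n).ne', sub_self]
  have hgb : ∀ n, ∀ x ∈ Icc a b, |g n x| ≤ C + 1 + C' := by
    intro n x hx
    simp only [g]
    rw [abs_mul]
    have h1 := hpb n x hx
    have h2 := abs_sub ((p n).eval x) (c n)
    have h3 := hC' n
    nlinarith [hχb n x, abs_nonneg (χ n x), abs_nonneg ((p n).eval x - c n)]
  have hgt : ∀ x ∈ Ioo a b, Tendsto (fun n => g n x) atTop (nhds (dφ x)) := by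
    intro x hx
    have h1 := (hpt x (Ioo_subset_Icc_self hx)).sub hc
    rw [sub_zero] at h1
    refine h1.congr' ?_
    filter_upwards [hχ1 x hx] with n hn
    simp only [g]
    rw [hn, one_mul]
  let F : ℕ → ℝ → ℝ := fun n x => ∫ t in a..x, g n t
  have hF : ∀ n x, HasDerivAt (F n) (g n x) x := fun n x =>
    intervalIntegral.integral_hasDerivAt_right ((hgs n).continuous.intervalIntegrable _ _)
      ((hgs n).continuous.stronglyMeasurableAtFilter _ _) (hgs n).continuous.continuousAt
  have hdF : ∀ n, deriv (F n) = g n := fun n => funext fun x => (hF n x).deriv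
  have hC0 : 0 ≤ C + 1 + C' :=
    (abs_nonneg _).trans (hgb 0 a (left_mem_Icc.mpr hab.le))
  refine ⟨F, ?_, (C + 1 + C') * (1 + (b - a)), by nlinarith, ?_, ?_⟩
  · intro n
    refine ⟨contDiff_infty_iff_deriv.mpr ⟨fun x => (hF n x).differentiableAt, ?_⟩, ?_⟩
    · rw [hdF]; exact hgs n
    · have hs : tsupport (F n) ⊆ Metric.closedBall m (χ n).rOut := by
        refine closure_minimal ?_ Metric.isClosed_closedBall
        intro x hx
        by_contra hx'
        apply hx
        rw [Metric.mem_closedBall, Real.dist_eq, not_le, lt_abs] at hx'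
        have ho := hout n
        rcases hx' with h | h
        · have : F n x = (∫ t in a..b, g n t) + ∫ t in b..x, g n t :=
            (intervalIntegral.integral_add_adjacent_intervals
              ((hgs n).continuous.intervalIntegrable _ _)
              ((hgs n).continuous.intervalIntegrable _ _)).symm
          rw [this, hg0, zero_add]
          apply intervalIntegral.integral_zero_ae
          refine Eventually.of_forall fun t ht => ?_
          have ht := uIoc_subset_uIcc ht
          have : (χ n).rOut < |t - m| := by
            rw [lt_abs]; left
            have := ht.1
            rcases le_total b x with h3 | h3
            · rw [inf_eq_left.mpr h3] at this; linarith
            · rw [inf_eq_right.mpr h3] at this; linarith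
          simp only [g]
          rw [hχ0 n t this, zero_mul]
        · apply intervalIntegral.integral_zero_ae
          refine Eventually.of_forall fun t ht => ?_
          have ht := uIoc_subset_uIcc ht
          have : (χ n).rOut < |t - m| := by
            rw [lt_abs]; right
            have := ht.2
            rcases le_total a x with h3 | h3
            · rw [sup_eq_right.mpr h3] at this; linarith
            · rw [sup_eq_left.mpr h3] at this; linarith
          simp only [g]
          rw [hχ0 n t this, zero_mul]
      refine hs.trans ?_
      intro x hx
      rw [Metric.mem_closedBall, Real.dist_eq, abs_le] at hx
      have ho := hout n
      constructor <;> linarith [hx.1, hx.2]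
  · intro n x hx
    rw [hdF]
    have h2 := hgb n x hx
    constructor
    · have := intervalIntegral.norm_integral_le_of_norm_le_const (a := a) (b := x) (f := g n)
        (C := C + 1 + C') (fun t ht => by
          rw [uIoc_of_le hx.1] at ht
          exact hgb n t ⟨ht.1.le, ht.2.trans hx.2⟩)
      rw [Real.norm_eq_abs, abs_of_nonneg (by linarith [hx.1] : 0 ≤ x - a)] at this
      refine this.trans (mul_le_mul_of_nonneg_left (by linarith [hx.2]) hC0)
    · nlinarith
  · intro x hx
    constructor
    · have : φ x = ∫ t in a..x, dφ t := by
        rw [intervalIntegral.integral_eq_sub_of_hasDerivAt (fun x _ => der x)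
          (cont.intervalIntegrable _ _), za, sub_zero]
      rw [this]
      refine intervalIntegral.tendsto_integral_filter_of_dominated_convergence
        (fun _ => C + 1 + C')
        (Eventually.of_forall fun n => (hgs n).continuous.aestronglyMeasurable) ?_
        intervalIntegrable_const ?_
      · refine Eventually.of_forall fun n => Eventually.of_forall fun t ht => ?_
        rw [uIoc_of_le hx.1.le] at ht
        exact hgb n t ⟨ht.1.le, ht.2.trans hx.2.le⟩
      · refine Eventually.of_forall fun t ht => ?_
        rw [uIoc_of_le hx.1.le] at ht
        exact hgt t ⟨ht.1, ht.2.trans_lt hx.2⟩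
    · simp_rw [hdF]
      exact hgt x hx

theorem PosEig.upper {v φ dφ d2 : ℝ → ℝ} {lam a b c : ℝ} (H : PosEig v φ dφ d2 lam a b c)
    (hv : ∀ a b, IntervalIntegrable v volume a b) {ε : ℝ} (hε : 0 < ε) :
    ∃ f, IsTestFun a b f ∧ f ≠ 0 ∧ rayleighQuotient v a b f < lam + ε := by
  obtain ⟨F, hF, K, hK, hb, ht⟩ := approx_test H.hab H.der H.cont H.za H.zb
  have cφ : Continuous φ := continuous_iff_continuousAt.mpr fun x => (H.der x).continuousAt
  have n2 : ∀ᵐ x : ℝ, x ≠ b := by simp [ae_iff]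
  have sub : uIoc a b ⊆ Icc a b := by rw [uIoc_of_le H.hab.le]; exact Ioc_subset_Icc_self
  have cF : ∀ n, Continuous (F n) := fun n => (hF n).1.continuous
  have cdF : ∀ n, Continuous (deriv (F n)) := fun n =>
    (contDiff_infty_iff_deriv.mp (hF n).1).2.continuous
  have I1 : Tendsto (fun n => ∫ x in a..b, (F n x) ^ 2) atTop (nhds (∫ x in a..b, (φ x) ^ 2)) := by
    refine intervalIntegral.tendsto_integral_filter_of_dominated_convergence (fun _ => K ^ 2)
      (Eventually.of_forall fun n => ((cF n).pow 2).aestronglyMeasurable) ?_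
      intervalIntegrable_const ?_
    · refine Eventually.of_forall fun n => Eventually.of_forall fun x hx => ?_
      rw [norm_pow]
      exact pow_le_pow_left₀ (norm_nonneg _) (hb n x (sub hx)).1 2
    · filter_upwards [n2] with x hxb hx
      rw [uIoc_of_le H.hab.le] at hx
      exact (ht x ⟨hx.1, lt_of_le_of_ne hx.2 hxb⟩).1.pow 2
  have I2 : Tendsto (fun n => ∫ x in a..b, ((deriv (F n) x) ^ 2 + v x * (F n x) ^ 2)) atTop
      (nhds (∫ x in a..b, ((dφ x) ^ 2 + v x * (φ x) ^ 2))) := by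
    refine intervalIntegral.tendsto_integral_filter_of_dominated_convergence
      (fun x => K ^ 2 + |v x| * K ^ 2)
      (Eventually.of_forall fun n => ?_) ?_ ?_ ?_
    · have := (((cdF n).pow 2).intervalIntegrable a b (μ := volume)).add
        ((hv a b).mul_continuousOn ((cF n).pow 2).continuousOn)
      exact this.def'.aestronglyMeasurable
    · refine Eventually.of_forall fun n => Eventually.of_forall fun x hx => ?_
      refine (norm_add_le _ _).trans ?_
      rw [norm_mul, norm_pow, norm_pow]
      have h1 := pow_le_pow_left₀ (norm_nonneg (F n x)) (hb n x (sub hx)).1 2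
      have h2 := pow_le_pow_left₀ (norm_nonneg (deriv (F n) x)) (hb n x (sub hx)).2 2
      exact add_le_add h2 (mul_le_mul_of_nonneg_left h1 (norm_nonneg _))
    · exact intervalIntegrable_const.add ((hv a b).abs.mul_const _)
    · filter_upwards [n2] with x hxb hx
      rw [uIoc_of_le H.hab.le] at hx
      have := ht x ⟨hx.1, lt_of_le_of_ne hx.2 hxb⟩
      exact (this.2.pow 2).add ((this.1.pow 2).const_mul _)
  have hpos : 0 < ∫ x in a..b, (φ x) ^ 2 :=
    intervalIntegral.intervalIntegral_pos_of_pos_on ((cφ.pow 2).intervalIntegrable _ _)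
      (fun x hx => pow_pos (H.pos x hx) 2) H.hab
  have I3 := I2.div I1 hpos.ne'
  rw [H.energy hv, mul_div_cancel_right₀ _ hpos.ne'] at I3
  obtain ⟨n, h1, h2⟩ := ((I3.eventually (gt_mem_nhds (by linarith : lam < lam + ε))).and
    (I1.eventually (lt_mem_nhds hpos))).exists
  refine ⟨F n, hF n, ?_, h1⟩
  intro h
  rw [h] at h2
  simp at h2

theorem IsTestFun.diff {a b : ℝ} {f : ℝ → ℝ} (h : IsTestFun a b f) : Differentiable ℝ f :=
  (contDiff_infty_iff_deriv.mp h.1).1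

theorem IsTestFun.cderiv {a b : ℝ} {f : ℝ → ℝ} (h : IsTestFun a b f) : Continuous (deriv f) :=
  (contDiff_infty_iff_deriv.mp h.1).2.continuous

theorem IsTestFun.zero_of_not_mem {a b : ℝ} {f : ℝ → ℝ} (h : IsTestFun a b f) {x : ℝ}
    (hx : x ∉ Ioo a b) : f x = 0 ∧ deriv f x = 0 := by
  have h1 : x ∉ tsupport f := fun h' => hx (h.2 h')
  have h2 := notMem_tsupport_iff_eventuallyEq.mp h1
  exact ⟨h2.eq_of_nhds, by rw [h2.deriv_eq]; simp⟩

theorem IsTestFun.norm_pos {a b : ℝ} {f : ℝ → ℝ} (h : IsTestFun a b f) (hf : f ≠ 0) :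
    0 < ∫ x in a..b, (f x) ^ 2 := by
  obtain ⟨x, hx⟩ := Function.ne_iff.mp hf
  have hx' : x ∈ Ioo a b := by
    by_contra hc
    exact hx (h.zero_of_not_mem hc).1
  refine intervalIntegral.integral_pos (hx'.1.trans hx'.2) (h.diff.continuous.pow 2).continuousOn
    (fun y _ => sq_nonneg _) ⟨x, Ioo_subset_Icc_self hx', ?_⟩
  exact pow_pos_of_ne_zero hx
where
  pow_pos_of_ne_zero {y : ℝ} (hy : y ≠ 0) : 0 < y ^ 2 := by positivity

theorem IsTestFun.int {a b : ℝ} {f v : ℝ → ℝ} (h : IsTestFun a b f)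
    (hv : ∀ a b, IntervalIntegrable v volume a b) (s t : ℝ) :
    IntervalIntegrable (fun x => (deriv f x) ^ 2 + v x * (f x) ^ 2) volume s t :=
  ((h.cderiv.pow 2).intervalIntegrable _ _).add
    ((hv s t).mul_continuousOn (h.diff.continuous.pow 2).continuousOn)

theorem IsTestFun.int2 {a b : ℝ} {f : ℝ → ℝ} (h : IsTestFun a b f) (s t : ℝ) :
    IntervalIntegrable (fun x => (f x) ^ 2) volume s t :=
  (h.diff.continuous.pow 2).intervalIntegrable _ _

theorem rq_nonneg {v : ℝ → ℝ} (hv0 : ∀ x, 0 ≤ v x) {a b : ℝ} (hab : a ≤ b) (f : ℝ → ℝ) :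
    0 ≤ rayleighQuotient v a b f := by
  apply div_nonneg
  · exact intervalIntegral.integral_nonneg hab fun x _ =>
      add_nonneg (sq_nonneg _) (mul_nonneg (hv0 x) (sq_nonneg _))
  · exact intervalIntegral.integral_nonneg hab fun x _ => sq_nonneg _

theorem rq_smul {v : ℝ → ℝ} {a b : ℝ} {f : ℝ → ℝ} {c : ℝ} (hc : c ≠ 0) :
    rayleighQuotient v a b (c • f) = rayleighQuotient v a b f := by
  unfold rayleighQuotient
  have h1 : ∀ x, deriv (c • f) x ^ 2 + v x * ((c • f) x) ^ 2
      = c ^ 2 * (deriv f x ^ 2 + v x * (f x) ^ 2) := by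
    intro x
    have : deriv (c • f) x = c * deriv f x := by
      rw [deriv_const_smul_field]; simp
    rw [this]
    simp only [Pi.smul_apply, smul_eq_mul]
    ring
  have h2 : ∀ x, ((c • f) x) ^ 2 = c ^ 2 * (f x) ^ 2 := by
    intro x
    simp only [Pi.smul_apply, smul_eq_mul]
    ring
  simp_rw [h1, h2]
  rw [intervalIntegral.integral_const_mul, intervalIntegral.integral_const_mul]
  exact mul_div_mul_left _ _ (pow_ne_zero 2 hc)

theorem rq_bdd {v : ℝ → ℝ} (hv0 : ∀ x, 0 ≤ v x) (hv : ∀ a b, IntervalIntegrable v volume a b)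
    {a b : ℝ} (hab : a < b) {n : ℕ} (W : Submodule ℝ (ℝ → ℝ))
    (hW : Module.finrank ℝ W = n + 1) (hT : ∀ f ∈ W, IsTestFun a b f) :
    BddAbove (range fun f : {f : ℝ → ℝ // f ∈ W ∧ f ≠ 0} => rayleighQuotient v a b f.1) := by
  have : Module.Finite ℝ W := Module.finite_of_finrank_pos (by omega)
  let e := Module.finBasisOfFinrankEq ℝ W hW
  let T : (Fin (n + 1) → ℝ) → ℝ → ℝ := fun s x => ∑ i, s i * (e i : ℝ → ℝ) x
  have hTe : ∀ s, T s = ((∑ i, s i • e i : W) : ℝ → ℝ) := by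
    intro s
    funext x
    simp [T, Finset.sum_apply]
  have hTW : ∀ s, T s ∈ W := fun s => by rw [hTe]; exact Submodule.coe_mem _
  have hT0 : ∀ s, T s = 0 → s = 0 := by
    intro s hs
    rw [hTe] at hs
    have h1 : (∑ i, s i • e i : W) = 0 := Subtype.ext hs
    have := Fintype.linearIndependent_iff.mp e.linearIndependent s h1
    exact funext this
  have ce : ∀ i, Continuous (e i : ℝ → ℝ) := fun i => (hT _ (e i).2).diff.continuous
  have cde : ∀ i, Continuous (deriv (e i : ℝ → ℝ)) := fun i => (hT _ (e i).2).cderiv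
  have dT : ∀ s x, deriv (T s) x = ∑ i, s i * deriv (e i : ℝ → ℝ) x := by
    intro s x
    simp only [T]
    rw [deriv_fun_sum fun i _ => ((hT _ (e i).2).diff x).const_mul _]
    refine Finset.sum_congr rfl fun i _ => ?_
    rw [deriv_const_mul _ ((hT _ (e i).2).diff x)]
  have cN : Continuous fun s => ∫ x in a..b, (T s x) ^ 2 := by
    apply intervalIntegral.continuous_parametric_intervalIntegral_of_continuous'
    simp only [T, Function.uncurry_def]
    refine (continuous_finsetSum _ fun i _ => ?_).pow 2
    exact ((continuous_apply i).comp continuous_fst).mul ((ce i).comp continuous_snd)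
  have hne : (Metric.sphere (0 : Fin (n + 1) → ℝ) 1).Nonempty := by
    refine ⟨fun _ => 1, ?_⟩
    rw [mem_sphere_zero_iff_norm, pi_norm_const]
    simp
  obtain ⟨s0, hs0, hmin⟩ := (isCompact_sphere (0 : Fin (n + 1) → ℝ) 1).exists_isMinOn hne
    cN.continuousOn
  have hs0n : s0 ≠ 0 := by
    rintro rfl
    simp at hs0
  have hcpos : 0 < ∫ x in a..b, (T s0 x) ^ 2 :=
    (hT _ (hTW s0)).norm_pos fun h => hs0n (hT0 _ h)
  set cc := ∫ x in a..b, (T s0 x) ^ 2 with hcc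
  set CC := ∫ x in a..b, ((∑ i, |deriv (e i : ℝ → ℝ) x|) ^ 2 +
    v x * (∑ i, |(e i : ℝ → ℝ) x|) ^ 2) with hCC
  have key : ∀ s ∈ Metric.sphere (0 : Fin (n + 1) → ℝ) 1, rayleighQuotient v a b (T s) ≤ CC / cc := by
    intro s hs
    have hsi : ∀ i, |s i| ≤ 1 := by
      intro i
      have := norm_le_pi_norm s i
      rwa [mem_sphere_zero_iff_norm.mp hs] at this
    have hsum : ∀ w : Fin (n + 1) → ℝ, (∑ i, s i * w i) ^ 2 ≤ (∑ i, |w i|) ^ 2 := by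
      intro w
      apply sq_le_sq'
      · rw [neg_le, ← Finset.sum_neg_distrib]
        refine Finset.sum_le_sum fun i _ => ?_
        refine (neg_le_abs _).trans ?_
        rw [abs_mul]
        nlinarith [hsi i, abs_nonneg (w i)]
      · refine Finset.sum_le_sum fun i _ => ?_
        refine (le_abs_self _).trans ?_
        rw [abs_mul]
        nlinarith [hsi i, abs_nonneg (w i)]
    have hCle : ∫ x in a..b, ((deriv (T s) x) ^ 2 + v x * (T s x) ^ 2) ≤ CC := by
      refine intervalIntegral.integral_mono_on hab.le ((hT _ (hTW s)).int hv a b) ?_ ?_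
      · refine IntervalIntegrable.add ?_ ((hv a b).mul_continuousOn ?_)
        · exact ((continuous_finsetSum _ fun i _ => (cde i).abs).pow 2).intervalIntegrable _ _
        · exact ((continuous_finsetSum _ fun i _ => (ce i).abs).pow 2).continuousOn
      · intro x _
        rw [dT]
        exact add_le_add (hsum _) (mul_le_mul_of_nonneg_left (hsum _) (hv0 x))
    have hC0 : 0 ≤ CC := intervalIntegral.integral_nonneg hab.le fun x _ =>
      add_nonneg (sq_nonneg _) (mul_nonneg (hv0 x) (sq_nonneg _))
    exact div_le_div₀ hC0 hCle hcpos (hmin hs)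
  refine ⟨CC / cc, ?_⟩
  rintro _ ⟨⟨f, hfW, hf0⟩, rfl⟩
  simp only
  let s : Fin (n + 1) → ℝ := fun i => e.repr ⟨f, hfW⟩ i
  have hTs : T s = f := by
    rw [hTe]
    have := e.sum_repr ⟨f, hfW⟩
    simp only [s]
    rw [this]
  have hs : s ≠ 0 := by
    intro h
    apply hf0
    rw [← hTs, h]
    funext x
    simp [T]
  have hns : ‖s‖ ≠ 0 := norm_ne_zero_iff.mpr hs
  have hsc : T (‖s‖⁻¹ • s) = ‖s‖⁻¹ • f := by
    rw [← hTs]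
    funext x
    simp [T, Finset.mul_sum, mul_assoc]
  have := key (‖s‖⁻¹ • s) (by
    rw [mem_sphere_zero_iff_norm, norm_smul, norm_inv, norm_norm, inv_mul_cancel₀ hns])
  rwa [hsc, rq_smul (inv_ne_zero hns)] at this

theorem dirichletEV_le {v : ℝ → ℝ} (hv0 : ∀ x, 0 ≤ v x) {a b : ℝ} (hab : a ≤ b) {n : ℕ} {s : ℝ}
    (hs : 0 ≤ s) (W : Submodule ℝ (ℝ → ℝ)) (hW : Module.finrank ℝ W = n + 1)
    (hT : ∀ f ∈ W, IsTestFun a b f) (h : ∀ f ∈ W, f ≠ 0 → rayleighQuotient v a b f ≤ s) :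
    dirichletEV v a b n ≤ s := by
  unfold dirichletEV
  refine (ciInf_le ⟨0, ?_⟩ (⟨W, hW, hT⟩ : {W : Submodule ℝ (ℝ → ℝ) //
      Module.finrank ℝ (↥W) = n + 1 ∧ ∀ f ∈ W, IsTestFun a b f})).trans ?_
  · rintro _ ⟨W, rfl⟩
    exact Real.iSup_nonneg fun f => rq_nonneg hv0 hab _
  · exact Real.iSup_le (fun f => h _ f.2.1 f.2.2) hs

theorem le_dirichletEV {v : ℝ → ℝ} (hv0 : ∀ x, 0 ≤ v x)
    (hv : ∀ a b, IntervalIntegrable v volume a b) {a b : ℝ} (hab : a < b) {n : ℕ} {s : ℝ}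
    (hne : ∃ W : Submodule ℝ (ℝ → ℝ), Module.finrank ℝ W = n + 1 ∧ ∀ f ∈ W, IsTestFun a b f)
    (h : ∀ W : Submodule ℝ (ℝ → ℝ), Module.finrank ℝ W = n + 1 → (∀ f ∈ W, IsTestFun a b f) →
      ∃ f ∈ W, f ≠ 0 ∧ s ≤ rayleighQuotient v a b f) :
    s ≤ dirichletEV v a b n := by
  unfold dirichletEV
  obtain ⟨W0, h0⟩ := hne
  have : Nonempty {W : Submodule ℝ (ℝ → ℝ) //
      Module.finrank ℝ (↥W) = n + 1 ∧ ∀ f ∈ W, IsTestFun a b f} := ⟨⟨W0, h0⟩⟩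
  refine le_ciInf fun W => ?_
  obtain ⟨f, hf, hf0, hs⟩ := h W.1 W.2.1 W.2.2
  exact hs.trans (le_ciSup (rq_bdd hv0 hv hab W.1 W.2.1 W.2.2)
    (⟨f, hf, hf0⟩ : {f : ℝ → ℝ // f ∈ W.1 ∧ f ≠ 0}))

theorem IsTestFun.smul {a b c : ℝ} {f : ℝ → ℝ} (h : IsTestFun a b f) : IsTestFun a b (c • f) :=
  ⟨h.1.const_smul c, (tsupport_smul_subset_right (fun _ => c) f).trans h.2⟩

theorem IsTestFun.add {a b : ℝ} {f g : ℝ → ℝ} (h : IsTestFun a b f) (h' : IsTestFun a b g) :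
    IsTestFun a b (f + g) :=
  ⟨h.1.add h'.1, (tsupport_add f g).trans (union_subset h.2 h'.2)⟩

theorem PosEig.ev0 {v φ dφ d2 : ℝ → ℝ} {lam a b c : ℝ} (H : PosEig v φ dφ d2 lam a b c)
    (hlam : 0 ≤ lam)
    (hv0 : ∀ x, 0 ≤ v x) (hv : ∀ a b, IntervalIntegrable v volume a b) :
    dirichletEV v a b 0 = lam := by
  have up : ∀ ε > 0, ∃ W : Submodule ℝ (ℝ → ℝ), Module.finrank ℝ W = 0 + 1 ∧
      (∀ f ∈ W, IsTestFun a b f) ∧ ∀ f ∈ W, f ≠ 0 → rayleighQuotient v a b f ≤ lam + ε := by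
    intro ε hε
    obtain ⟨f, hf, hf0, hR⟩ := H.upper hv hε
    refine ⟨Submodule.span ℝ {f}, finrank_span_singleton hf0, ?_, ?_⟩
    · intro g hg
      obtain ⟨s, rfl⟩ := Submodule.mem_span_singleton.mp hg
      exact hf.smul
    · intro g hg hg0
      obtain ⟨s, rfl⟩ := Submodule.mem_span_singleton.mp hg
      rw [rq_smul (by rintro rfl; simp at hg0)]
      exact hR.le
  apply le_antisymm
  · refine le_of_forall_pos_le_add fun ε hε => ?_
    obtain ⟨W, h1, h2, h3⟩ := up ε hε
    exact dirichletEV_le hv0 H.hab.le (by linarith) W h1 h2 h3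
  · obtain ⟨W, h1, h2, -⟩ := up 1 one_pos
    refine le_dirichletEV hv0 hv H.hab ⟨W, h1, h2⟩ ?_
    intro W hW hT
    have : Nontrivial W := Module.nontrivial_of_finrank_pos (R := ℝ) (by omega)
    obtain ⟨f, hf⟩ := exists_ne (0 : W)
    have hf0 : (f : ℝ → ℝ) ≠ 0 := fun h => hf (Subtype.ext h)
    have hft := hT f f.2
    refine ⟨f, f.2, hf0, ?_⟩
    rw [rayleighQuotient, le_div_iff₀ (hft.norm_pos hf0)]
    exact H.lower hv hft.diff hft.cderiv (hft.zero_of_not_mem (by simp)).1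
      (hft.zero_of_not_mem (by simp)).1

theorem deriv_reflect (f : ℝ → ℝ) (x : ℝ) : deriv (fun y => f (-y)) x = -deriv f (-x) := by
  exact deriv_comp_neg f x

theorem reflect_int {v : ℝ → ℝ} (hve : ∀ x, v (-x) = v x) (f : ℝ → ℝ) (s t : ℝ) :
    (∫ x in s..t, ((deriv (fun y => f (-y)) x) ^ 2 + v x * (f (-x)) ^ 2)) =
      ∫ x in (-t)..(-s), ((deriv f x) ^ 2 + v x * (f x) ^ 2) := by
  rw [← intervalIntegral.integral_comp_neg fun x => (deriv f x) ^ 2 + v x * (f x) ^ 2]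
  refine intervalIntegral.integral_congr fun x _ => ?_
  rw [deriv_reflect, hve]
  ring

theorem PosEig.ev1 {v φ dφ d2 : ℝ → ℝ} {lam b c : ℝ} (H : PosEig v φ dφ d2 lam 0 b c)
    (hlam : 0 ≤ lam) (hve : ∀ x, v (-x) = v x)
    (hv0 : ∀ x, 0 ≤ v x) (hv : ∀ a b, IntervalIntegrable v volume a b) :
    dirichletEV v (-b) b 1 = lam := by
  have hb := H.hab
  have up : ∀ ε > 0, ∃ W : Submodule ℝ (ℝ → ℝ), Module.finrank ℝ W = 1 + 1 ∧
      (∀ f ∈ W, IsTestFun (-b) b f) ∧ ∀ f ∈ W, f ≠ 0 → rayleighQuotient v (-b) b f ≤ lam + ε := by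
    intro ε hε
    obtain ⟨f, hf, hf0, hR⟩ := H.upper hv hε
    set g : ℝ → ℝ := fun x => f (-x) with hg
    have hzf : ∀ x ≤ 0, f x = 0 ∧ deriv f x = 0 := fun x hx =>
      hf.zero_of_not_mem (fun h => absurd h.1 (not_lt.mpr hx))
    have hzg : ∀ x, 0 ≤ x → g x = 0 ∧ deriv g x = 0 := by
      intro x hx
      have := hzf (-x) (by linarith)
      refine ⟨this.1, ?_⟩
      rw [hg, deriv_reflect, this.2, neg_zero]
    have hft : IsTestFun (-b) b f :=
      ⟨hf.1, hf.2.trans (Ioo_subset_Ioo_left (by linarith))⟩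
    have hgt : IsTestFun (-b) b g := by
      refine ⟨hf.1.comp contDiff_neg, ?_⟩
      have : tsupport g ⊆ (fun x => -x) ⁻¹' tsupport f :=
        closure_minimal (fun x hx => subset_tsupport f hx)
          ((isClosed_tsupport f).preimage continuous_neg)
      intro x hx
      have := hf.2 (this hx)
      constructor <;> linarith [this.1, this.2]
    obtain ⟨x0, hx0⟩ := Function.ne_iff.mp hf0
    have hx0 : f x0 ≠ 0 := hx0
    have hx0p : 0 ≤ x0 := by
      by_contra h
      exact hx0 (hzf x0 (by linarith)).1
    have hli : LinearIndependent ℝ ![f, g] := by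
      rw [LinearIndependent.pair_iff]
      intro s t hst
      have e1 := congrFun hst x0
      have e2 := congrFun hst (-x0)
      simp only [Pi.add_apply, Pi.smul_apply, smul_eq_mul, Pi.zero_apply] at e1 e2
      rw [(hzg x0 hx0p).1] at e1
      rw [(hzf (-x0) (by linarith)).1] at e2
      have : g (-x0) = f x0 := by simp [hg]
      rw [this] at e2
      constructor
      · simpa [hx0] using e1
      · simpa [hx0] using e2
    refine ⟨Submodule.span ℝ {f, g}, ?_, ?_, ?_⟩
    · have := finrank_span_eq_card hli
      rw [Matrix.range_cons, Matrix.range_cons, Matrix.range_empty, union_empty,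
        singleton_union] at this
      simpa using this
    · intro h hh
      obtain ⟨s, t, rfl⟩ := Submodule.mem_span_pair.mp hh
      exact hft.smul.add hgt.smul
    · intro h hh hh0
      obtain ⟨s, t, rfl⟩ := Submodule.mem_span_pair.mp hh
      have hht : IsTestFun (-b) b (s • f + t • g) := hft.smul.add hgt.smul
      have hd : ∀ x, deriv (s • f + t • g) x = s * deriv f x + t * deriv g x := by
        intro x
        rw [deriv_add ((hft.diff x).const_smul s) ((hgt.diff x).const_smul t),
          deriv_const_smul_field, deriv_const_smul_field]
        simp
      have hNf := hf.norm_pos hf0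
      rw [rayleighQuotient, div_lt_iff₀ hNf] at hR
      rw [rayleighQuotient, div_le_iff₀ (hht.norm_pos hh0)]
      rw [← intervalIntegral.integral_add_adjacent_intervals (hht.int hv (-b) 0) (hht.int hv 0 b),
        ← intervalIntegral.integral_add_adjacent_intervals
          (hht.int2 (-b) 0)
          (hht.int2 0 b)]
      have q1 : ∫ x in (-b)..0, ((deriv (s • f + t • g) x) ^ 2 + v x * ((s • f + t • g) x) ^ 2)
          = t ^ 2 * ∫ x in 0..b, ((deriv f x) ^ 2 + v x * (f x) ^ 2) := by
        have := reflect_int hve f (-b) 0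
        rw [neg_neg, neg_zero] at this
        rw [← this, ← intervalIntegral.integral_const_mul]
        refine intervalIntegral.integral_congr fun x hx => ?_
        rw [uIcc_of_le (by linarith)] at hx
        simp only [hd, Pi.add_apply, Pi.smul_apply, smul_eq_mul, (hzf x hx.2).1, (hzf x hx.2).2]
        simp only [hg]
        ring
      have q2 : ∫ x in 0..b, ((deriv (s • f + t • g) x) ^ 2 + v x * ((s • f + t • g) x) ^ 2)
          = s ^ 2 * ∫ x in 0..b, ((deriv f x) ^ 2 + v x * (f x) ^ 2) := by
        rw [← intervalIntegral.integral_const_mul]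
        refine intervalIntegral.integral_congr fun x hx => ?_
        rw [uIcc_of_le (by linarith)] at hx
        simp only [hd, Pi.add_apply, Pi.smul_apply, smul_eq_mul, (hzg x hx.1).1, (hzg x hx.1).2]
        ring
      have q3 : ∫ x in (-b)..0, ((s • f + t • g) x) ^ 2 = t ^ 2 * ∫ x in 0..b, (f x) ^ 2 := by
        have := intervalIntegral.integral_comp_neg (a := -b) (b := 0) fun x => (f x) ^ 2
        rw [neg_neg, neg_zero] at this
        rw [← this, ← intervalIntegral.integral_const_mul]
        refine intervalIntegral.integral_congr fun x hx => ?_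
        rw [uIcc_of_le (by linarith)] at hx
        simp only [Pi.add_apply, Pi.smul_apply, smul_eq_mul, (hzf x hx.2).1, hg]
        ring
      have q4 : ∫ x in 0..b, ((s • f + t • g) x) ^ 2 = s ^ 2 * ∫ x in 0..b, (f x) ^ 2 := by
        rw [← intervalIntegral.integral_const_mul]
        refine intervalIntegral.integral_congr fun x hx => ?_
        rw [uIcc_of_le (by linarith)] at hx
        simp only [Pi.add_apply, Pi.smul_apply, smul_eq_mul, (hzg x hx.1).1]
        ring
      rw [q1, q2, q3, q4]
      nlinarith [mul_le_mul_of_nonneg_left hR.le (add_nonneg (sq_nonneg s) (sq_nonneg t))]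
  apply le_antisymm
  · refine le_of_forall_pos_le_add fun ε hε => ?_
    obtain ⟨W, h1, h2, h3⟩ := up ε hε
    exact dirichletEV_le hv0 (by linarith) (by linarith) W h1 h2 h3
  · obtain ⟨W, h1, h2, -⟩ := up 1 one_pos
    refine le_dirichletEV hv0 hv (by linarith) ⟨W, h1, h2⟩ ?_
    intro W hW hT
    have : Module.Finite ℝ W := Module.finite_of_finrank_pos (by omega)
    let ev : W →ₗ[ℝ] ℝ := (LinearMap.proj (R := ℝ) (φ := fun _ : ℝ => ℝ) 0).comp W.subtype
    have hk : LinearMap.ker ev ≠ ⊥ := LinearMap.ker_ne_bot_of_finrank_lt (by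
      rw [hW, Module.finrank_self]; norm_num)
    obtain ⟨f, hfk, hf⟩ := Submodule.exists_mem_ne_zero_of_ne_bot hk
    have hf0 : (f : ℝ → ℝ) ≠ 0 := fun h => hf (Subtype.ext h)
    have hz : (f : ℝ → ℝ) 0 = 0 := hfk
    have hft := hT f f.2
    refine ⟨f, f.2, hf0, ?_⟩
    set F : ℝ → ℝ := (f : ℝ → ℝ) with hF
    rw [rayleighQuotient, le_div_iff₀ (hft.norm_pos hf0)]
    rw [← intervalIntegral.integral_add_adjacent_intervals (hft.int hv (-b) 0) (hft.int hv 0 b),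
        ← intervalIntegral.integral_add_adjacent_intervals
          (hft.int2 (-b) 0)
          (hft.int2 0 b)]
    have r1 := H.lower hv hft.diff hft.cderiv hz (hft.zero_of_not_mem (by simp)).1
    have r2 := H.lower hv (f := fun x => F (-x)) (hft.diff.comp differentiable_neg)
      (by
        have : deriv (fun x => F (-x)) = fun x => -deriv F (-x) := funext (deriv_reflect F)
        rw [this]
        exact (hft.cderiv.comp continuous_neg).neg)
      (by simpa using hz) (hft.zero_of_not_mem (by simp)).1
    rw [reflect_int hve, intervalIntegral.integral_comp_neg fun x => (F x) ^ 2, neg_zero] at r2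
    linarith

theorem tanh_pos_of_pos {x : ℝ} (hx : 0 < x) : 0 < Real.tanh x := by
  rw [Real.tanh_eq_sinh_div_cosh]
  exact div_pos (Real.sinh_pos_iff.mpr hx) (Real.cosh_pos x)

theorem tanh_mono {x y : ℝ} (hxy : x ≤ y) : Real.tanh x ≤ Real.tanh y := by
  rw [Real.tanh_eq_sinh_div_cosh, Real.tanh_eq_sinh_div_cosh,
    div_le_div_iff₀ (Real.cosh_pos x) (Real.cosh_pos y)]
  have : 0 ≤ Real.sinh (y - x) := Real.sinh_nonneg_iff.mpr (by linarith)
  rw [Real.sinh_sub] at this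
  linarith

theorem tanh_cont : Continuous Real.tanh := by
  have : Real.tanh = fun x => Real.sinh x / Real.cosh x := funext Real.tanh_eq_sinh_div_cosh
  rw [this]
  exact Real.continuous_sinh.div Real.continuous_cosh fun x => (Real.cosh_pos x).ne'

theorem stepW_nonneg {v₀ b L : ℝ} (hv₀ : 0 < v₀) (x : ℝ) : 0 ≤ stepW v₀ b L x := by
  unfold stepW
  split_ifs <;> positivity

theorem stepW_even {v₀ b L : ℝ} (x : ℝ) : stepW v₀ b L (-x) = stepW v₀ b L x := by
  unfold stepW
  rw [abs_neg]

theorem stepW_int {v₀ b L : ℝ} (s t : ℝ) : IntervalIntegrable (stepW v₀ b L) volume s t := by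
  have hm : Measurable (stepW v₀ b L) := by
    unfold stepW
    exact Measurable.ite (measurableSet_le measurable_norm measurable_const) measurable_const
      measurable_const
  refine (intervalIntegrable_const (c := |v₀ * L ^ 2|)).mono_fun' hm.aestronglyMeasurable ?_
  refine Eventually.of_forall fun x => ?_
  simp only [stepW]
  split_ifs
  · exact le_rfl
  · rw [norm_zero]; exact abs_nonneg _

theorem der_sin_add (ω : ℝ) (x : ℝ) : HasDerivAt (fun x => Real.sin (ω * (1/2 + x)))
    (ω * Real.cos (ω * (1/2 + x))) x := by
  have h : HasDerivAt (fun x : ℝ => ω * (1/2 + x)) ω x := by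
    exact (((hasDerivAt_id x).const_add (1/2)).const_mul ω).congr_deriv (by ring)
  exact h.sin.congr_deriv (by ring)

theorem der_cos_add (ω : ℝ) (x : ℝ) : HasDerivAt (fun x => ω * Real.cos (ω * (1/2 + x)))
    (-ω ^ 2 * Real.sin (ω * (1/2 + x))) x := by
  have h : HasDerivAt (fun x : ℝ => ω * (1/2 + x)) ω x := by
    exact (((hasDerivAt_id x).const_add (1/2)).const_mul ω).congr_deriv (by ring)
  exact (h.cos.const_mul ω).congr_deriv (by ring)

theorem der_sin_sub (ω : ℝ) (x : ℝ) : HasDerivAt (fun x => Real.sin (ω * (1/2 - x)))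
    (-ω * Real.cos (ω * (1/2 - x))) x := by
  have h : HasDerivAt (fun x : ℝ => ω * (1/2 - x)) (-ω) x := by
    exact (((hasDerivAt_id x).const_sub (1/2)).const_mul ω).congr_deriv (by ring)
  exact (h.sin).congr_deriv (by ring)

theorem der_cos_sub (ω : ℝ) (x : ℝ) : HasDerivAt (fun x => -ω * Real.cos (ω * (1/2 - x)))
    (-ω ^ 2 * Real.sin (ω * (1/2 - x))) x := by
  have h : HasDerivAt (fun x : ℝ => ω * (1/2 - x)) (-ω) x := by
    exact (((hasDerivAt_id x).const_sub (1/2)).const_mul ω).congr_deriv (by ring)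
  exact (h.cos.const_mul (-ω)).congr_deriv (by ring)

theorem der_cosh (k M : ℝ) (x : ℝ) : HasDerivAt (fun x => k * Real.cosh (M * x))
    (k * M * Real.sinh (M * x)) x := by
  have h : HasDerivAt (fun x : ℝ => M * x) M x := by
    simpa using (hasDerivAt_id x).const_mul M
  exact (h.cosh.const_mul k).congr_deriv (by ring)

theorem der_sinh (k M : ℝ) (x : ℝ) : HasDerivAt (fun x => k * Real.sinh (M * x))
    (k * M * Real.cosh (M * x)) x := by
  have h : HasDerivAt (fun x : ℝ => M * x) M x := by
    simpa using (hasDerivAt_id x).const_mul M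
  exact (h.sinh.const_mul k).congr_deriv (by ring)

theorem even_eig {v₀ b L ω M : ℝ} (hv₀ : 0 < v₀) (hl : 0 < b / L) (hl' : b / L < 1/2) (hω : 0 < ω)
    (hωπ : ω * (1/2 - b / L) < π) (hM : M ^ 2 = v₀ * L ^ 2 - ω ^ 2)
    (hE : M * Real.sinh (M * (b / L)) * Real.sin (ω * (1/2 - b / L)) =
      -ω * Real.cos (ω * (1/2 - b / L)) * Real.cosh (M * (b / L))) :
    dirichletEV (stepW v₀ b L) (-(1/2)) (1/2) 0 = ω ^ 2 := by
  set l := b / L with hldef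
  set k := Real.sin (ω * (1/2 - l)) / Real.cosh (M * l) with hk
  have hch := Real.cosh_pos (M * l)
  have hsp : 0 < Real.sin (ω * (1/2 - l)) :=
    Real.sin_pos_of_pos_of_lt_pi (mul_pos hω (by linarith)) hωπ
  have hkp : 0 < k := div_pos hsp hch
  have m1 : k * Real.cosh (M * l) = Real.sin (ω * (1/2 - l)) := by
    rw [hk, div_mul_cancel₀ _ hch.ne']
  have m2 : k * M * Real.sinh (M * l) = -ω * Real.cos (ω * (1/2 - l)) := by
    rw [hk, div_mul_eq_mul_div, div_mul_eq_mul_div, div_eq_iff hch.ne', ← hE]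
    ring
  have H : PosEig (stepW v₀ b L)
      (fun x => if x < -l then Real.sin (ω * (1/2 + x)) else
        if x < l then k * Real.cosh (M * x) else Real.sin (ω * (1/2 - x)))
      (fun x => if x < -l then ω * Real.cos (ω * (1/2 + x)) else
        if x < l then k * M * Real.sinh (M * x) else -ω * Real.cos (ω * (1/2 - x)))
      (fun x => if x < -l then -ω ^ 2 * Real.sin (ω * (1/2 + x)) else
        if x < l then k * M * M * Real.cosh (M * x) else -ω ^ 2 * Real.sin (ω * (1/2 - x)))
      (ω ^ 2) (-(1/2)) (1/2) l := by
    have hpos : ∀ x ∈ Ioo (-(1/2) : ℝ) (1/2), 0 < (if x < -l then Real.sin (ω * (1/2 + x)) else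
        if x < l then k * Real.cosh (M * x) else Real.sin (ω * (1/2 - x))) := by
      intro x hx
      split_ifs with h1 h2
      · refine Real.sin_pos_of_pos_of_lt_pi (mul_pos hω (by linarith [hx.1])) ?_
        refine lt_of_le_of_lt (mul_le_mul_of_nonneg_left ?_ hω.le) hωπ
        linarith
      · exact mul_pos hkp (Real.cosh_pos _)
      · refine Real.sin_pos_of_pos_of_lt_pi (mul_pos hω (by linarith [hx.2])) ?_
        refine lt_of_le_of_lt (mul_le_mul_of_nonneg_left ?_ hω.le) hωπ
        linarith
    have hnl : ¬ (l < -l) := by linarith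
    have heq : ∀ x ∈ Ioo (-(1/2) : ℝ) (1/2), x ≠ l →
        (if x < -l then -ω ^ 2 * Real.sin (ω * (1/2 + x)) else
        if x < l then k * M * M * Real.cosh (M * x) else -ω ^ 2 * Real.sin (ω * (1/2 - x)))
        = (stepW v₀ b L x - ω ^ 2) * (if x < -l then Real.sin (ω * (1/2 + x)) else
        if x < l then k * Real.cosh (M * x) else Real.sin (ω * (1/2 - x))) := by
      intro x hx hxl
      unfold stepW
      rw [← hldef]
      split_ifs with h1 h2 h3 h4 h5
      · rw [abs_le] at h2; linarith
      · ring
      · rw [← hM]; ring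
      · exact absurd (abs_le.mpr ⟨by linarith, by linarith⟩) h4
      · rw [abs_le] at h5; exact absurd (le_antisymm h5.2 (by linarith)) hxl
      · ring
    refine ⟨by norm_num, ?_, ?_, ?_, ?_, heq, hpos, ?_, ?_, ?_, ?_⟩
    · refine glue_hasDerivAt (der_sin_add ω)
        (glue_hasDerivAt (der_cosh k M) (der_sin_sub ω) m1 m2) ?_ ?_
      · simp only [show -l < l by linarith, if_true]
        rw [mul_neg, Real.cosh_neg, m1]; ring_nf
      · simp only [show -l < l by linarith, if_true]
        rw [mul_neg, Real.sinh_neg, mul_neg, m2]; ring_nf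
    · refine glue_cont (by fun_prop) (glue_cont ?_ (by fun_prop) m2) ?_
      · exact continuous_const.mul (Real.continuous_sinh.comp (continuous_const.mul continuous_id))
      · simp only [show -l < l by linarith, if_true]
        rw [mul_neg, Real.sinh_neg, mul_neg, m2]; ring_nf
    · exact glue_rder (fun x => (der_cos_add ω x).hasDerivWithinAt)
        (glue_rder (fun x => (der_sinh (k * M) M x).hasDerivWithinAt)
          (fun x => (der_cos_sub ω x).hasDerivWithinAt))
    · intro x hx
      by_cases hxl : x = l
      · have hp := hpos x hx
        subst hxl
        simp only [hnl, lt_irrefl, if_false] at hp ⊢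
        have := stepW_nonneg (b := b) (L := L) hv₀ l
        nlinarith
      · exact (heq x hx hxl).le
    · simp only [show (-(1/2) : ℝ) < -l by linarith, if_true]; simp
    · simp only [show ¬ ((1/2 : ℝ) < -l) by linarith, show ¬ ((1/2 : ℝ) < l) by linarith, if_false]
      simp
    · simp only [show (-(1/2) : ℝ) < -l by linarith, if_true]; simp [hω.ne']
    · simp only [show ¬ ((1/2 : ℝ) < -l) by linarith, show ¬ ((1/2 : ℝ) < l) by linarith, if_false]
      simp [hω.ne']
  exact H.ev0 (sq_nonneg ω) (stepW_nonneg hv₀) stepW_int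

theorem odd_eig {v₀ b L ω M : ℝ} (hv₀ : 0 < v₀) (hl : 0 < b / L) (hl' : b / L < 1/2) (hω : 0 < ω)
    (hMp : 0 < M)
    (hωπ : ω * (1/2 - b / L) < π) (hM : M ^ 2 = v₀ * L ^ 2 - ω ^ 2)
    (hE : M * Real.cosh (M * (b / L)) * Real.sin (ω * (1/2 - b / L)) =
      -ω * Real.cos (ω * (1/2 - b / L)) * Real.sinh (M * (b / L))) :
    dirichletEV (stepW v₀ b L) (-(1/2)) (1/2) 1 = ω ^ 2 := by
  set l := b / L with hldef
  set k := Real.sin (ω * (1/2 - l)) / Real.sinh (M * l) with hk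
  have hch := Real.sinh_pos_iff.mpr (mul_pos hMp hl)
  have hsp : 0 < Real.sin (ω * (1/2 - l)) :=
    Real.sin_pos_of_pos_of_lt_pi (mul_pos hω (by linarith)) hωπ
  have hkp : 0 < k := div_pos hsp hch
  have m1 : k * Real.sinh (M * l) = Real.sin (ω * (1/2 - l)) := by
    rw [hk, div_mul_cancel₀ _ hch.ne']
  have m2 : k * M * Real.cosh (M * l) = -ω * Real.cos (ω * (1/2 - l)) := by
    rw [hk, div_mul_eq_mul_div, div_mul_eq_mul_div, div_eq_iff hch.ne', ← hE]
    ring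
  have H : PosEig (stepW v₀ b L)
      (fun x => if x < l then k * Real.sinh (M * x) else Real.sin (ω * (1/2 - x)))
      (fun x => if x < l then k * M * Real.cosh (M * x) else -ω * Real.cos (ω * (1/2 - x)))
      (fun x => if x < l then k * M * M * Real.sinh (M * x) else -ω ^ 2 * Real.sin (ω * (1/2 - x)))
      (ω ^ 2) 0 (1/2) l := by
    have hpos : ∀ x ∈ Ioo (0 : ℝ) (1/2), 0 < (
        if x < l then k * Real.sinh (M * x) else Real.sin (ω * (1/2 - x))) := by
      intro x hx
      split_ifs with h2
      · exact mul_pos hkp (Real.sinh_pos_iff.mpr (mul_pos hMp hx.1))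
      · refine Real.sin_pos_of_pos_of_lt_pi (mul_pos hω (by linarith [hx.2])) ?_
        refine lt_of_le_of_lt (mul_le_mul_of_nonneg_left ?_ hω.le) hωπ
        linarith
    have heq : ∀ x ∈ Ioo (0 : ℝ) (1/2), x ≠ l →
        (if x < l then k * M * M * Real.sinh (M * x) else -ω ^ 2 * Real.sin (ω * (1/2 - x)))
        = (stepW v₀ b L x - ω ^ 2) * (
        if x < l then k * Real.sinh (M * x) else Real.sin (ω * (1/2 - x))) := by
      intro x hx hxl
      have hx1 := hx.1
      unfold stepW
      rw [← hldef]
      split_ifs with h3 h4 h5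
      · rw [← hM]; ring
      · exact absurd (abs_le.mpr ⟨by linarith, by linarith⟩) h4
      · rw [abs_le] at h5; exact absurd (le_antisymm h5.2 (by linarith)) hxl
      · ring
    refine ⟨by norm_num, ?_, ?_, ?_, ?_, heq, hpos, ?_, ?_, ?_, ?_⟩
    · exact glue_hasDerivAt (der_sinh k M) (der_sin_sub ω) m1 m2
    · refine glue_cont ?_ (by fun_prop) m2
      exact continuous_const.mul (Real.continuous_cosh.comp (continuous_const.mul continuous_id))
    · exact glue_rder (fun x => (der_cosh (k * M) M x).hasDerivWithinAt)
          (fun x => (der_cos_sub ω x).hasDerivWithinAt)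
    · intro x hx
      by_cases hxl : x = l
      · have hp := hpos x hx
        subst hxl
        simp only [lt_irrefl, if_false] at hp ⊢
        have := stepW_nonneg (b := b) (L := L) hv₀ l
        nlinarith
      · exact (heq x hx hxl).le
    · simp only [hl, if_true]; simp
    · simp only [show ¬ ((1/2 : ℝ) < l) by linarith, if_false]
      simp
    · simp only [hl, if_true]; simp [hkp.ne', hMp.ne']
    · simp only [show ¬ ((1/2 : ℝ) < l) by linarith, if_false]
      simp [hω.ne']
  exact H.ev1 (sq_nonneg ω) stepW_even (stepW_nonneg hv₀) stepW_int

theorem root_exists {l₁ : ℝ} (hl : 0 < l₁) (X : ℝ → ℝ) (hc : ContinuousOn X (Icc 0 (π / l₁)))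
    (h0 : X 0 = 0) (hp : ∀ w ∈ Ioc 0 (π / l₁), 0 < X w) :
    ∃ w, 0 < w ∧ π / 2 < w * l₁ ∧ w * l₁ < π ∧ w * l₁ = π - Real.arctan (X w) := by
  have hq : 0 < π / l₁ := div_pos Real.pi_pos hl
  have hF : ContinuousOn (fun w => w * l₁ + Real.arctan (X w)) (Icc 0 (π / l₁)) :=
    (continuousOn_id.mul continuousOn_const).add (Real.continuous_arctan.comp_continuousOn hc)
  have hmem : π ∈ Icc ((fun w => w * l₁ + Real.arctan (X w)) 0)
      ((fun w => w * l₁ + Real.arctan (X w)) (π / l₁)) := by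
    constructor
    · simp [h0, Real.pi_pos.le]
    · have := Real.arctan_pos.mpr (hp _ ⟨hq, le_rfl⟩)
      simp only
      rw [div_mul_cancel₀ _ hl.ne']
      linarith
  obtain ⟨w, hw, hwe⟩ := intermediate_value_Icc hq.le hF hmem
  simp only at hwe
  have h1 := Real.arctan_lt_pi_div_two (X w)
  have h2 : π / 2 < w * l₁ := by linarith
  have hw0 : 0 < w := by
    by_contra h
    nlinarith [Real.pi_pos]
  have h3 := Real.arctan_pos.mpr (hp w ⟨hw0, hw.2⟩)
  exact ⟨w, hw0, h2, by linarith, by linarith⟩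

theorem sin_cos_of_root {θ X : ℝ} (h : θ = π - Real.arctan X) :
    Real.sin θ = -X * Real.cos θ := by
  rw [h, Real.sin_pi_sub, Real.cos_pi_sub]
  have h1 := Real.tan_arctan X
  rw [Real.tan_eq_sin_div_cos, div_eq_iff (Real.cos_arctan_pos X).ne'] at h1
  linarith

theorem alg_even {M S C w c : ℝ} (hM : M ≠ 0) (hS : S ≠ 0) (hC : C ≠ 0) :
    M * S * (-(w / M * (S / C)⁻¹) * c) = -w * c * C := by
  field_simp

theorem alg_odd {M S C w c : ℝ} (hM : M ≠ 0) (hC : C ≠ 0) :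
    M * C * (-(w / M * (S / C)) * c) = -w * c * S := by
  field_simp

theorem eigen_structure {v₀ b L : ℝ} (hv₀ : 0 < v₀) (hl : 0 < b / L) (hl' : b / L < 1/2)
    (hbig : (π / (1/2 - b / L)) ^ 2 < v₀ * L ^ 2) :
    (let ω := Real.sqrt (dirichletEV (stepW v₀ b L) (-(1/2)) (1/2) 0)
     0 < ω ∧ π / 2 < ω * (1/2 - b / L) ∧ ω * (1/2 - b / L) < π ∧
      ω * (1/2 - b / L) = π - Real.arctan ((ω / Real.sqrt (v₀ * L ^ 2 - ω ^ 2)) *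
        (Real.tanh (Real.sqrt (v₀ * L ^ 2 - ω ^ 2) * (b / L)))⁻¹)) ∧
    (let ω := Real.sqrt (dirichletEV (stepW v₀ b L) (-(1/2)) (1/2) 1)
     0 < ω ∧ π / 2 < ω * (1/2 - b / L) ∧ ω * (1/2 - b / L) < π ∧
      ω * (1/2 - b / L) = π - Real.arctan ((ω / Real.sqrt (v₀ * L ^ 2 - ω ^ 2)) *
        (Real.tanh (Real.sqrt (v₀ * L ^ 2 - ω ^ 2) * (b / L))))) := by
  have hl1 : 0 < 1/2 - b / L := by linarith
  have hMp : ∀ w ∈ Icc 0 (π / (1/2 - b / L)), 0 < v₀ * L ^ 2 - w ^ 2 := by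
    intro w hw
    have := pow_le_pow_left₀ hw.1 hw.2 2
    linarith
  have hsp : ∀ w ∈ Icc 0 (π / (1/2 - b / L)), 0 < Real.sqrt (v₀ * L ^ 2 - w ^ 2) :=
    fun w hw => Real.sqrt_pos.mpr (hMp w hw)
  have htp : ∀ w ∈ Icc 0 (π / (1/2 - b / L)),
      0 < Real.tanh (Real.sqrt (v₀ * L ^ 2 - w ^ 2) * (b / L)) :=
    fun w hw => tanh_pos_of_pos (mul_pos (hsp w hw) hl)
  have cM : Continuous fun w : ℝ => Real.sqrt (v₀ * L ^ 2 - w ^ 2) := by fun_prop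
  have cT : Continuous fun w : ℝ => Real.tanh (Real.sqrt (v₀ * L ^ 2 - w ^ 2) * (b / L)) :=
    tanh_cont.comp (cM.mul continuous_const)
  have c1 : ContinuousOn (fun w : ℝ => w / Real.sqrt (v₀ * L ^ 2 - w ^ 2))
      (Icc 0 (π / (1/2 - b / L))) :=
    continuousOn_id.div cM.continuousOn fun w hw => (hsp w hw).ne'
  constructor
  · obtain ⟨w, hw0, h1, h2, h3⟩ := root_exists hl1
      (fun ω => (ω / Real.sqrt (v₀ * L ^ 2 - ω ^ 2)) *
        (Real.tanh (Real.sqrt (v₀ * L ^ 2 - ω ^ 2) * (b / L)))⁻¹)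
      (c1.mul (cT.continuousOn.inv₀ fun w hw => (htp w hw).ne')) (by simp)
      (fun w hw => mul_pos (div_pos hw.1 (hsp w (Ioc_subset_Icc_self hw)))
        (inv_pos.mpr (htp w (Ioc_subset_Icc_self hw))))
    have hwI : w ∈ Icc 0 (π / (1/2 - b / L)) := ⟨hw0.le, by rw [le_div_iff₀ hl1]; exact h2.le⟩
    have hM := hsp w hwI
    have hev := even_eig (M := Real.sqrt (v₀ * L ^ 2 - w ^ 2)) hv₀ hl hl' hw0 h2
      (Real.sq_sqrt (hMp w hwI).le) (by
        rw [sin_cos_of_root h3, Real.tanh_eq_sinh_div_cosh]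
        exact alg_even hM.ne' (Real.sinh_pos_iff.mpr (mul_pos hM hl)).ne' (Real.cosh_pos _).ne')
    rw [hev, Real.sqrt_sq hw0.le]
    exact ⟨hw0, h1, h2, h3⟩
  · obtain ⟨w, hw0, h1, h2, h3⟩ := root_exists hl1
      (fun ω => (ω / Real.sqrt (v₀ * L ^ 2 - ω ^ 2)) *
        (Real.tanh (Real.sqrt (v₀ * L ^ 2 - ω ^ 2) * (b / L))))
      (c1.mul cT.continuousOn) (by simp)
      (fun w hw => mul_pos (div_pos hw.1 (hsp w (Ioc_subset_Icc_self hw)))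
        (htp w (Ioc_subset_Icc_self hw)))
    have hwI : w ∈ Icc 0 (π / (1/2 - b / L)) := ⟨hw0.le, by rw [le_div_iff₀ hl1]; exact h2.le⟩
    have hM := hsp w hwI
    have hev := odd_eig (M := Real.sqrt (v₀ * L ^ 2 - w ^ 2)) hv₀ hl hl' hw0 hM h2
      (Real.sq_sqrt (hMp w hwI).le) (by
        rw [sin_cos_of_root h3, Real.tanh_eq_sinh_div_cosh]
        exact alg_odd hM.ne' (Real.cosh_pos _).ne')
    rw [hev, Real.sqrt_sq hw0.le]
    exact ⟨hw0, h1, h2, h3⟩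

set_option maxHeartbeats 2000000 in
theorem real_part {b v₀ s t r τ D L l₁ l₂ ω₀ ω₁ M₀ M₁ X₀ X₁ : ℝ} (hb : 0 < b) (hs : 0 < s)
    (hsv : s ^ 2 = v₀) (ht : t = Real.tanh (s * b)) (hr : r = (1 + t) / 2)
    (hτ : τ = Real.tanh (r * s * b)) (hD : D = 4 * π / (r * s * τ))
    (hL : 0 < L) (hl₂ : l₂ = b / L) (hl₁ : l₁ = 1/2 - l₂) (hl4 : l₂ ≤ 1/4)
    (hL1 : 16 * π ^ 2 ≤ (1 - r ^ 2) * (v₀ * L ^ 2)) (hL2 : D ≤ L)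
    (hL3 : 4 * D ≤ π * (1 - t / r) / 2 * L)
    (hω₀ : 0 < ω₀) (hω₁ : 0 < ω₁)
    (a0 : π / 2 < ω₀ * l₁) (a0' : ω₀ * l₁ < π) (a1' : ω₁ * l₁ < π)
    (hM₀ : M₀ = Real.sqrt (v₀ * L ^ 2 - ω₀ ^ 2)) (hM₁ : M₁ = Real.sqrt (v₀ * L ^ 2 - ω₁ ^ 2))
    (hX₀ : X₀ = (ω₀ / M₀) * (Real.tanh (M₀ * l₂))⁻¹)
    (hX₁ : X₁ = (ω₁ / M₁) * Real.tanh (M₁ * l₂))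
    (e0 : ω₀ * l₁ = π - Real.arctan X₀) (e1 : ω₁ * l₁ = π - Real.arctan X₁) :
    ω₁ - ω₀ = l₁⁻¹ * ∫ t in X₁..X₀, 1 / (1 + t ^ 2) ∧
        l₁⁻¹ * (X₀ - X₁) / (1 + X₀ ^ 2) ≤ ω₁ - ω₀ ∧
        ω₁ - ω₀ ≤ l₁⁻¹ * (X₀ - X₁) / (1 + X₁ ^ 2) ∧
        (π * (1 - t / r) / (2 * s)) / L ≤ ω₁ - ω₀ ∧ ω₁ - ω₀ ≤ (4 * D) / L := by
  have hπ := Real.pi_pos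
  have hl2p : 0 < l₂ := by rw [hl₂]; positivity
  have hl1a : 1/4 ≤ l₁ := by linarith
  have hl1b : l₁ ≤ 1/2 := by linarith
  have hl1p : 0 < l₁ := by linarith
  have ht0 : 0 < t := by rw [ht]; exact tanh_pos_of_pos (mul_pos hs hb)
  have ht1 : t < 1 := by rw [ht]; exact Real.tanh_lt_one _
  have hr0 : 0 < r := by linarith
  have hr1 : r < 1 := by linarith
  have htr : t < r := by linarith
  have hτ0 : 0 < τ := by rw [hτ]; exact tanh_pos_of_pos (by positivity)
  have hD0 : 0 < D := by rw [hD]; positivity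
  have hsL : 0 < s * L := mul_pos hs hL
  have hlL : s * L * l₂ = s * b := by rw [hl₂]; field_simp
  have b0 : ω₀ ≤ 4 * π := by have := mul_le_mul_of_nonneg_left hl1a hω₀.le; linarith only [this, a0']
  have b1 : ω₁ ≤ 4 * π := by have := mul_le_mul_of_nonneg_left hl1a hω₁.le; linarith only [this, a1']
  have b0' : π ≤ ω₀ := by have := mul_le_mul_of_nonneg_left hl1b hω₀.le; linarith only [this, a0]
  -- bounds on M
  have Mlow : ∀ w, 0 < w → w ≤ 4 * π → r * (s * L) ≤ Real.sqrt (v₀ * L ^ 2 - w ^ 2) := by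
    intro w h1 h2
    apply Real.le_sqrt_of_sq_le
    have : w ^ 2 ≤ (4 * π) ^ 2 := pow_le_pow_left₀ h1.le h2 2
    rw [← hsv] at hL1 ⊢
    have e1 : (r * (s * L)) ^ 2 = s ^ 2 * L ^ 2 - (1 - r ^ 2) * (s ^ 2 * L ^ 2) := by ring
    have e2 : (4 * π) ^ 2 = 16 * π ^ 2 := by ring
    linarith only [e1, e2, this, hL1]
  have Mup : ∀ w : ℝ, Real.sqrt (v₀ * L ^ 2 - w ^ 2) ≤ s * L := by
    intro w
    rw [Real.sqrt_le_left hsL.le, ← hsv]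
    have e1 : (s * L) ^ 2 = s ^ 2 * L ^ 2 := by ring
    linarith only [e1, sq_nonneg w]
  have m0 : r * (s * L) ≤ M₀ := by rw [hM₀]; exact Mlow _ hω₀ b0
  have m1 : r * (s * L) ≤ M₁ := by rw [hM₁]; exact Mlow _ hω₁ b1
  have m0' : M₀ ≤ s * L := by rw [hM₀]; exact Mup _
  have m1' : M₁ ≤ s * L := by rw [hM₁]; exact Mup _
  have hrsL : 0 < r * (s * L) := by positivity
  have M0p : 0 < M₀ := by linarith
  have M1p : 0 < M₁ := by linarith
  have T0 : τ ≤ Real.tanh (M₀ * l₂) := by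
    rw [hτ]
    apply tanh_mono
    have := mul_le_mul_of_nonneg_right m0 hl2p.le
    calc r * s * b = r * (s * L * l₂) := by rw [hlL]; ring
      _ = r * (s * L) * l₂ := by ring
      _ ≤ _ := this
  have T0p : 0 < Real.tanh (M₀ * l₂) := by linarith
  have T01 : Real.tanh (M₀ * l₂) < 1 := Real.tanh_lt_one _
  have T1 : Real.tanh (M₁ * l₂) ≤ t := by
    rw [ht, ← hlL]
    exact tanh_mono (mul_le_mul_of_nonneg_right m1' hl2p.le)
  have T1p : 0 < Real.tanh (M₁ * l₂) := tanh_pos_of_pos (mul_pos M1p hl2p)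
  have X1p : 0 < X₁ := by rw [hX₁]; positivity
  have X0p : 0 < X₀ := by rw [hX₀]; positivity
  have X0ge : ω₀ / M₀ ≤ X₀ := by
    rw [hX₀]
    exact le_mul_of_one_le_right (by positivity) (one_le_inv_iff₀.mpr ⟨T0p, T01.le⟩)
  have X1le : X₁ ≤ ω₁ / M₁ * t := by
    rw [hX₁]
    exact mul_le_mul_of_nonneg_left T1 (by positivity)
  have hdiff : (ω₁ - ω₀) * l₁ = Real.arctan X₀ - Real.arctan X₁ := by linarith
  have hω : ω₀ ≤ ω₁ := by
    by_contra h
    rw [not_le] at h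
    have hMM : M₀ ≤ M₁ := by
      rw [hM₀, hM₁]
      apply Real.sqrt_le_sqrt
      have := pow_le_pow_left₀ hω₁.le h.le 2
      linarith only [this]
    have h1 : X₁ ≤ X₀ := by
      calc X₁ ≤ ω₁ / M₁ * t := X1le
        _ ≤ ω₁ / M₁ := mul_le_of_le_one_right (by positivity) ht1.le
        _ ≤ ω₀ / M₀ := div_le_div₀ hω₀.le h.le M0p hMM
        _ ≤ X₀ := X0ge
    have h2 := Real.arctan_strictMono.monotone h1
    have h3 := mul_neg_of_neg_of_pos (sub_neg.mpr h) hl1p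
    linarith only [h2, h3, hdiff]
  have hXX : X₁ ≤ X₀ := by
    have : Real.arctan X₁ ≤ Real.arctan X₀ := by have := mul_nonneg (sub_nonneg.mpr hω) hl1p.le; linarith only [this, hdiff]
    exact Real.arctan_strictMono.le_iff_le.mp this
  have hIntegralEq : ω₁ - ω₀ = l₁⁻¹ * ∫ t in X₁..X₀, 1 / (1 + t ^ 2) := by
    rw [integral_one_div_one_add_sq, ← hdiff]
    field_simp
  have hci : IntervalIntegrable (fun t : ℝ => 1 / (1 + t ^ 2)) volume X₁ X₀ := by
    apply Continuous.intervalIntegrable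
    exact continuous_const.div (by fun_prop) fun x => by positivity
  have hlo : (X₀ - X₁) * (1 / (1 + X₀ ^ 2)) ≤ ∫ t in X₁..X₀, 1 / (1 + t ^ 2) := by
    have := intervalIntegral.integral_mono_on hXX
      (intervalIntegrable_const (c := 1 / (1 + X₀ ^ 2))) hci (fun x hx => by
        apply one_div_le_one_div_of_le (by positivity)
        have := pow_le_pow_left₀ (X1p.le.trans hx.1) hx.2 2
        linarith only [this])
    rwa [intervalIntegral.integral_const, smul_eq_mul] at this
  have hup : ∫ t in X₁..X₀, 1 / (1 + t ^ 2) ≤ (X₀ - X₁) * (1 / (1 + X₁ ^ 2)) := by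
    have := intervalIntegral.integral_mono_on hXX hci
      (intervalIntegrable_const (c := 1 / (1 + X₁ ^ 2))) (fun x hx => by
        apply one_div_le_one_div_of_le (by positivity)
        have := pow_le_pow_left₀ X1p.le hx.1 2
        linarith only [this])
    rwa [intervalIntegral.integral_const, smul_eq_mul] at this
  have hinv : 0 < l₁⁻¹ := inv_pos.mpr hl1p
  have hinv4 : l₁⁻¹ ≤ 4 := by
    rw [inv_le_comm₀ hl1p (by norm_num)]; linarith
  have hinv2 : 2 ≤ l₁⁻¹ := by
    rw [le_inv_comm₀ (by norm_num) hl1p]; linarith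
  have B1 : l₁⁻¹ * (X₀ - X₁) / (1 + X₀ ^ 2) ≤ ω₁ - ω₀ := by
    rw [hIntegralEq]
    calc _ = l₁⁻¹ * ((X₀ - X₁) * (1 / (1 + X₀ ^ 2))) := by ring
      _ ≤ _ := mul_le_mul_of_nonneg_left hlo hinv.le
  have B2 : ω₁ - ω₀ ≤ l₁⁻¹ * (X₀ - X₁) / (1 + X₁ ^ 2) := by
    rw [hIntegralEq]
    calc _ ≤ l₁⁻¹ * ((X₀ - X₁) * (1 / (1 + X₁ ^ 2))) := mul_le_mul_of_nonneg_left hup hinv.le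
      _ = _ := by ring
  have X0le : X₀ ≤ D / L := by
    have h1 : ω₀ / M₀ ≤ 4 * π / (r * (s * L)) := div_le_div₀ (by positivity) b0 hrsL m0
    have h2 : (Real.tanh (M₀ * l₂))⁻¹ ≤ τ⁻¹ := inv_anti₀ hτ0 T0
    calc X₀ ≤ 4 * π / (r * (s * L)) * τ⁻¹ := by
          rw [hX₀]; exact mul_le_mul h1 h2 (by positivity) (by positivity)
      _ = D / L := by rw [hD]; field_simp
  have B3 : ω₁ - ω₀ ≤ (4 * D) / L := by
    refine B2.trans ?_
    have h1 : l₁⁻¹ * (X₀ - X₁) ≤ 4 * (D / L) :=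
      mul_le_mul hinv4 (by linarith) (by linarith) (by norm_num)
    have h0 : 0 ≤ l₁⁻¹ * (X₀ - X₁) := mul_nonneg hinv.le (by linarith)
    refine (div_le_self h0 (by linarith only [sq_nonneg X₁])).trans ?_
    rw [mul_div_assoc]; exact h1
  refine ⟨hIntegralEq, B1, B2, ?_, B3⟩
  have X01 : X₀ ≤ 1 := X0le.trans ((div_le_one hL).mpr hL2)
  set q := t / r with hq
  have hq0 : 0 < q := div_pos ht0 hr0
  have hq1 : q < 1 := (div_lt_one hr0).mpr htr
  have u1 : s * L * X₁ ≤ ω₁ * q := by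
    have : X₁ ≤ ω₁ / (r * (s * L)) * t :=
      X1le.trans (mul_le_mul_of_nonneg_right (div_le_div_of_nonneg_left hω₁.le hrsL m1) ht0.le)
    calc s * L * X₁ ≤ s * L * (ω₁ / (r * (s * L)) * t) := mul_le_mul_of_nonneg_left this hsL.le
      _ = ω₁ * q := by rw [hq]; field_simp
  have u0 : ω₀ ≤ s * L * X₀ := by
    have : ω₀ / (s * L) ≤ X₀ := (div_le_div_of_nonneg_left hω₀.le M0p m0').trans X0ge
    rw [div_le_iff₀ hsL] at this
    linarith
  have u2 : (4 * D) / L ≤ π * (1 - q) / 2 := by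
    rw [div_le_iff₀ hL]; exact hL3
  have u3 : π * (1 - q) / 2 ≤ s * L * (X₀ - X₁) := by
    have : ω₁ * q ≤ ω₀ * q + (4 * D) / L := by
      have h4 : 0 ≤ (4 * D) / L := by positivity
      have h5 := mul_le_mul_of_nonneg_left hq1.le (sub_nonneg.mpr hω)
      linarith only [h5, B3]
    have h6 := mul_le_mul_of_nonneg_right b0' (sub_nonneg.mpr hq1.le)
    linarith only [h6, this, u0, u1, u2]
  have u4 : (π * (1 - q) / (2 * s)) / L ≤ X₀ - X₁ := by
    rw [div_div, div_le_iff₀ (by positivity)]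
    linarith
  refine (u4.trans ?_).trans B1
  rw [le_div_iff₀ (by positivity)]
  have h5 : X₀ ^ 2 ≤ 1 := by have := pow_le_pow_left₀ X0p.le X01 2; linarith only [this]
  have h6 : (X₀ - X₁) * (1 + X₀ ^ 2) ≤ (X₀ - X₁) * 2 :=
    mul_le_mul_of_nonneg_left (by linarith) (by linarith)
  have h7 : 2 * (X₀ - X₁) ≤ l₁⁻¹ * (X₀ - X₁) := mul_le_mul_of_nonneg_right hinv2 (by linarith)
  linarith

/-- for the step-potential operator `g_L` on `(-1/2,1/2)`, with
`ω_j = √λ_j(L)`, `M_j = √(v₀L² − ω_j²)`, `l₁ = 1/2 − b/L`, `l₂ = b/L`,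
`X₀ = (ω₀/M₀)(tanh(M₀l₂))⁻¹`, `X₁ = (ω₁/M₁)tanh(M₁l₂)`, one has for large `L`
`ω₁ − ω₀ = l₁⁻¹ ∫_{X₁}^{X₀} dt/(1+t²)`, the resulting two-sided bounds, and consequently
`c₁/L ≤ ω₁ − ω₀ ≤ c₂/L` for some constants `c₁, c₂ > 0`. -/
theorem step_potential_frequency_gap
    (v₀ b : ℝ) (hv₀ : 0 < v₀) (hb : 0 < b) :
    ∃ c₁ > 0, ∃ c₂ > 0,
      ∀ᶠ L : ℝ in atTop,
        let l₁ : ℝ := 1/2 - b / L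
        let l₂ : ℝ := b / L
        let ω₀ : ℝ := Real.sqrt (dirichletEV (stepW v₀ b L) (-(1/2)) (1/2) 0)
        let ω₁ : ℝ := Real.sqrt (dirichletEV (stepW v₀ b L) (-(1/2)) (1/2) 1)
        let M₀ : ℝ := Real.sqrt (v₀ * L ^ 2 - ω₀ ^ 2)
        let M₁ : ℝ := Real.sqrt (v₀ * L ^ 2 - ω₁ ^ 2)
        let X₀ : ℝ := (ω₀ / M₀) * (Real.tanh (M₀ * l₂))⁻¹
        let X₁ : ℝ := (ω₁ / M₁) * Real.tanh (M₁ * l₂)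
        ω₁ - ω₀ = l₁⁻¹ * ∫ t in X₁..X₀, 1 / (1 + t ^ 2) ∧
        l₁⁻¹ * (X₀ - X₁) / (1 + X₀ ^ 2) ≤ ω₁ - ω₀ ∧
        ω₁ - ω₀ ≤ l₁⁻¹ * (X₀ - X₁) / (1 + X₁ ^ 2) ∧
        c₁ / L ≤ ω₁ - ω₀ ∧ ω₁ - ω₀ ≤ c₂ / L := by
  obtain ⟨s, hs⟩ : ∃ s, s = Real.sqrt v₀ := ⟨_, rfl⟩
  obtain ⟨t, ht⟩ : ∃ t, t = Real.tanh (s * b) := ⟨_, rfl⟩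
  obtain ⟨r, hr⟩ : ∃ r, r = (1 + t) / 2 := ⟨_, rfl⟩
  obtain ⟨τ, hτ⟩ : ∃ τ, τ = Real.tanh (r * s * b) := ⟨_, rfl⟩
  obtain ⟨D, hD⟩ : ∃ D, D = 4 * π / (r * s * τ) := ⟨_, rfl⟩
  have hπ := Real.pi_pos
  have hs0 : 0 < s := by rw [hs]; exact Real.sqrt_pos.mpr hv₀
  have hsv : s ^ 2 = v₀ := by rw [hs]; exact Real.sq_sqrt hv₀.le
  have ht0 : 0 < t := by rw [ht]; exact tanh_pos_of_pos (mul_pos hs0 hb)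
  have ht1 : t < 1 := by rw [ht]; exact Real.tanh_lt_one _
  have hr0 : 0 < r := by linarith
  have hr1 : r < 1 := by linarith
  have htr : t < r := by linarith
  have hτ0 : 0 < τ := by rw [hτ]; exact tanh_pos_of_pos (by positivity)
  have hD0 : 0 < D := by rw [hD]; positivity
  have hq1 : 0 < 1 - t / r := by
    have := (div_lt_one hr0).mpr htr
    linarith
  have hr2 : 0 < 1 - r ^ 2 := by nlinarith
  refine ⟨π * (1 - t / r) / (2 * s), by positivity, 4 * D, by positivity, ?_⟩
  have E1 : ∀ᶠ L : ℝ in atTop, 16 * π ^ 2 ≤ (1 - r ^ 2) * (v₀ * L ^ 2) := by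
    have : Tendsto (fun L : ℝ => (1 - r ^ 2) * (v₀ * L ^ 2)) atTop atTop :=
      ((tendsto_pow_atTop two_ne_zero).const_mul_atTop hv₀).const_mul_atTop hr2
    exact this.eventually_ge_atTop _
  have E2 : ∀ᶠ L : ℝ in atTop, 4 * D ≤ π * (1 - t / r) / 2 * L := by
    have : Tendsto (fun L : ℝ => π * (1 - t / r) / 2 * L) atTop atTop :=
      tendsto_id.const_mul_atTop (by positivity)
    exact this.eventually_ge_atTop _
  filter_upwards [E1, E2, eventually_gt_atTop 0, eventually_ge_atTop (4 * b),
    eventually_ge_atTop D] with L h1 h2 h3 h4 h5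
  have hl : 0 < b / L := by positivity
  have hl4 : b / L ≤ 1/4 := by rw [div_le_iff₀ h3]; linarith
  have hbig : (π / (1/2 - b / L)) ^ 2 < v₀ * L ^ 2 := by
    have g1 : π / (1/2 - b / L) ≤ 4 * π := by
      rw [div_le_iff₀ (by linarith)]
      nlinarith
    have g2 := pow_le_pow_left₀ (div_nonneg hπ.le (by linarith)) g1 2
    have g3 : 0 < v₀ * L ^ 2 := by positivity
    nlinarith [mul_pos (pow_pos hr0 2) g3]
  obtain ⟨⟨p1, p2, p3, p4⟩, q1, q2, q3, q4⟩ := eigen_structure hv₀ hl (by linarith) hbig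
  exact real_part hb hs0 hsv ht hr hτ hD h3 rfl rfl hl4 h1 h5 h2 p1 q1 p2 p3 q3 rfl rfl rfl rfl
    p4 q4
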